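/- arXiv:math/0001106 — 4 statements merged into one kernel-verified Lean document; each statement's English description precedes it below -/
import Mathlib

section
/- Let ∇, ∇′ ⊆ ℝ^n be minimal lattice polytopes (vertices in ℤ^n, 0 in the interior, and removing any vertex destroys this), set Δ = conv(∇* ∩ ℤ^n) and Δ′ = conv(∇′* ∩ ℤ^n), and assume that Δ and Δ′ are reflexive. If ∇ is very minimal, i.e. for every vertex V of ∇ the convex hull of (Δ* ∩ ℤ^n) \ {V} does not contain 0 in its interior, then Δ is not a proper subset of Δ′. -/
/-- A point of `ℝ^n` is a lattice point if all its coordinates are integers. -/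
def IsLatticePt {n : ℕ} (x : Fin n → ℝ) : Prop := ∀ i, ∃ m : ℤ, x i = (m : ℝ)

/-- The dual (polar) set of `s ⊆ ℝ^n`. -/
def dualSet {n : ℕ} (s : Set (Fin n → ℝ)) : Set (Fin n → ℝ) :=
  {y | ∀ x ∈ s, -1 ≤ ∑ i, y i * x i}

/-- A lattice polytope: the convex hull of a finite set of lattice points. -/
def IsLatticePolytope {n : ℕ} (s : Set (Fin n → ℝ)) : Prop :=
  ∃ F : Set (Fin n → ℝ), F.Finite ∧ (∀ x ∈ F, IsLatticePt x) ∧ s = convexHull ℝ F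

/-- Duality reverses inclusions. -/
theorem dualSet_antitone {n : ℕ} {s t : Set (Fin n → ℝ)} (h : s ⊆ t) :
    dualSet t ⊆ dualSet s :=
  fun _ hy x hx => hy x (h hx)

/-- The dual of a set is convex. -/
theorem convex_dualSet {n : ℕ} (s : Set (Fin n → ℝ)) : Convex ℝ (dualSet s) := by
  intro x hx y hy a b ha hb hab z hz
  have hsum : ∑ i, (a • x + b • y) i * z i = a * ∑ i, x i * z i + b * ∑ i, y i * z i := by
    simp only [Pi.add_apply, Pi.smul_apply, smul_eq_mul, add_mul, Finset.sum_add_distrib,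
      Finset.mul_sum, mul_assoc]
  rw [hsum]
  nlinarith [mul_le_mul_of_nonneg_left (hx z hz) ha, mul_le_mul_of_nonneg_left (hy z hz) hb]

/-- A set lies in its bidual. -/
theorem subset_dualSet_dualSet {n : ℕ} (s : Set (Fin n → ℝ)) : s ⊆ dualSet (dualSet s) := by
  intro x hx y hy
  simpa only [mul_comm] using hy x hx

/-- A set lies in the dual of the convex hull of the lattice points of its dual. -/
theorem subset_dualSet_convexHull_lattice {n : ℕ} (s : Set (Fin n → ℝ)) :
    s ⊆ dualSet (convexHull ℝ {x ∈ dualSet s | IsLatticePt x}) :=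
  (subset_dualSet_dualSet s).trans <| dualSet_antitone <|
    convexHull_min (Set.sep_subset _ _) (convex_dualSet s)

/-- If `∇` is very minimal then `Δ = conv(∇* ∩ ℤ^n)` is not a proper subset of
`Δ' = conv(∇'* ∩ ℤ^n)` for any minimal lattice polytope `∇'`. -/
theorem stmt_12 (n : ℕ) (𝒱 𝒱' : Set (Fin n → ℝ))
    (h1 : 𝒱.Finite) (h1lat : ∀ x ∈ 𝒱, IsLatticePt x)
    (h1ip : (0 : Fin n → ℝ) ∈ interior (convexHull ℝ 𝒱))
    (h1min : ∀ V ∈ 𝒱, (0 : Fin n → ℝ) ∉ interior (convexHull ℝ (𝒱 \ {V})))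
    (h2 : 𝒱'.Finite) (h2lat : ∀ x ∈ 𝒱', IsLatticePt x)
    (h2ip : (0 : Fin n → ℝ) ∈ interior (convexHull ℝ 𝒱'))
    (h2min : ∀ V ∈ 𝒱', (0 : Fin n → ℝ) ∉ interior (convexHull ℝ (𝒱' \ {V})))
    (Δ Δ' : Set (Fin n → ℝ))
    (hΔ : Δ = convexHull ℝ {x ∈ dualSet (convexHull ℝ 𝒱) | IsLatticePt x})
    (hΔ' : Δ' = convexHull ℝ {x ∈ dualSet (convexHull ℝ 𝒱') | IsLatticePt x})
    (hrefl : IsLatticePolytope (dualSet Δ))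
    (hrefl' : IsLatticePolytope (dualSet Δ'))
    (hvm : ∀ V ∈ 𝒱, (0 : Fin n → ℝ) ∉
      interior (convexHull ℝ ({x ∈ dualSet Δ | IsLatticePt x} \ {V}))) :
    ¬ Δ ⊂ Δ' := by
  intro hss
  subst hΔ hΔ'
  have hsub' : 𝒱' ⊆ {x ∈ dualSet (convexHull ℝ {x ∈ dualSet (convexHull ℝ 𝒱) | IsLatticePt x}) |
      IsLatticePt x} := fun x hx =>
    ⟨dualSet_antitone hss.subset
      (subset_dualSet_convexHull_lattice _ (subset_convexHull ℝ _ hx)), h2lat x hx⟩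
  have hsub : 𝒱 ⊆ 𝒱' := by
    intro V hV
    by_contra hV'
    exact hvm V hV (interior_mono (convexHull_mono (Set.subset_sdiff_singleton hsub' hV')) h2ip)
  exact hss.not_subset <| convexHull_mono fun x hx =>
    ⟨dualSet_antitone (convexHull_mono hsub) hx.1, hx.2⟩
end

section
/- Let ∇ ⊆ ℝ^n be a minimal lattice polytope, set Δ = conv(∇* ∩ ℤ^n), and assume Δ is reflexive. If ∇ is very minimal, i.e. for every vertex V of ∇ the convex hull of (Δ* ∩ ℤ^n) \ {V} does not contain 0 in its interior, then: (i) every vertex of ∇ is a vertex of Δ* (∇ has the span property), and (ii) ∇ is lp-minimal, i.e. for every vertex V of ∇ the convex hull of (∇ ∩ ℤ^n) \ {V} does not contain 0 in its interior. -/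
/-- A lattice polytope is the convex hull of its extreme points. -/
theorem IsLatticePolytope.convexHull_extremePoints {n : ℕ} {s : Set (Fin n → ℝ)}
    (hs : IsLatticePolytope s) : convexHull ℝ (s.extremePoints ℝ) = s := by
  obtain ⟨F, hF, -, rfl⟩ := hs
  have hfin : ((convexHull ℝ F).extremePoints ℝ).Finite := hF.subset extremePoints_convexHull_subset
  rw [← (hfin.isClosed_convexHull (𝕜 := ℝ)).closure_eq]
  exact closure_convexHull_extremePoints (hF.isCompact_convexHull (𝕜 := ℝ)) (convex_convexHull ℝ F)

theorem IsLatticePolytope.isLatticePt_of_mem_extremePoints {n : ℕ} {s : Set (Fin n → ℝ)}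
    (hs : IsLatticePolytope s) {x : Fin n → ℝ} (hx : x ∈ s.extremePoints ℝ) : IsLatticePt x := by
  obtain ⟨F, -, hlat, rfl⟩ := hs
  exact hlat x (extremePoints_convexHull_subset hx)

/-- A very minimal polytope has the span property and is lp-minimal. -/
theorem stmt_13 (n : ℕ) (𝒱 : Set (Fin n → ℝ))
    (h1 : 𝒱.Finite) (h1lat : ∀ x ∈ 𝒱, IsLatticePt x)
    (h1ip : (0 : Fin n → ℝ) ∈ interior (convexHull ℝ 𝒱))
    (h1min : ∀ V ∈ 𝒱, (0 : Fin n → ℝ) ∉ interior (convexHull ℝ (𝒱 \ {V})))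
    (Δ : Set (Fin n → ℝ))
    (hΔ : Δ = convexHull ℝ {x ∈ dualSet (convexHull ℝ 𝒱) | IsLatticePt x})
    (hrefl : IsLatticePolytope (dualSet Δ))
    (hvm : ∀ V ∈ 𝒱, (0 : Fin n → ℝ) ∉
      interior (convexHull ℝ ({x ∈ dualSet Δ | IsLatticePt x} \ {V}))) :
    𝒱 ⊆ Set.extremePoints ℝ (dualSet Δ) ∧
    ∀ V ∈ 𝒱, (0 : Fin n → ℝ) ∉
      interior (convexHull ℝ ({x ∈ convexHull ℝ 𝒱 | IsLatticePt x} \ {V})) := by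
  have hsub : convexHull ℝ 𝒱 ⊆ dualSet Δ := by
    refine (subset_dualSet_dualSet _).trans (dualSet_antitone ?_)
    rw [hΔ]
    exact convexHull_min (fun _ hx => hx.1) (convex_dualSet _)
  refine ⟨fun V hV => ?_, fun V hV h0 => hvm V hV ?_⟩
  · by_contra hext
    refine hvm V hV (interior_mono ?_ (interior_mono hsub h1ip))
    conv_lhs => rw [← hrefl.convexHull_extremePoints]
    refine convexHull_mono fun x hx => ⟨⟨hx.1, hrefl.isLatticePt_of_mem_extremePoints hx⟩, ?_⟩
    rintro rfl
    exact hext hx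
  · refine interior_mono (convexHull_mono ?_) h0
    exact fun x hx => ⟨⟨hsub hx.1.1, hx.1.2⟩, hx.2⟩
end

section
/- Up to the natural action of GL(2, ℤ) on ℝ², there are exactly 16 reflexive polytopes in ℝ²: there is a set of 16 pairwise GL(2,ℤ)-inequivalent reflexive polygons such that every reflexive polygon in ℝ² is equal to the image of exactly one of them under some element of GL(2, ℤ). -/
/-- A reflexive polytope: a lattice polytope with the origin in its interior whose dual
is again a lattice polytope. -/
def IsReflexive {n : ℕ} (s : Set (Fin n → ℝ)) : Prop :=
  IsLatticePolytope s ∧ (0 : Fin n → ℝ) ∈ interior s ∧ IsLatticePolytope (dualSet s)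

/-- `t` is the image of `s` under an element of `GL(n, ℤ)`. -/
def GLZEquiv {n : ℕ} (s t : Set (Fin n → ℝ)) : Prop :=
  ∃ A : Matrix (Fin n) (Fin n) ℤ, IsUnit A.det ∧
    t = (fun x => (A.map ((↑) : ℤ → ℝ)).mulVec x) '' s

namespace ReflexivePolygon

/-- The standard pairing on `ℤ²`. -/
def ip (u v : ℤ × ℤ) : ℤ := u.1 * v.1 + u.2 * v.2

/-- The determinant of two vectors of `ℤ²`. -/
def dt (u v : ℤ × ℤ) : ℤ := u.1 * v.2 - u.2 * v.1

/-- The image of `v` under the integer matrix with columns `p` and `q`. -/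
def app (p q v : ℤ × ℤ) : ℤ × ℤ := (p.1 * v.1 + q.1 * v.2, p.2 * v.1 + q.2 * v.2)

/-- The vertices of the sixteen reflexive polygons, in cyclic order. -/
def vertices : Fin 16 → List (ℤ × ℤ) := ![
  [(-1, -1), (1, 0), (0, 1)],
  [(-1, 0), (2, -1), (0, 1)],
  [(-1, -1), (1, 0), (0, 1), (-1, 0)],
  [(-1, 0), (0, -1), (1, 0), (0, 1)],
  [(-1, -1), (1, 0), (0, 1), (-1, 1)],
  [(-1, -1), (0, -1), (1, 0), (0, 1), (-1, 0)],
  [(-1, -1), (1, 0), (-1, 2)],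
  [(-1, 0), (0, -1), (1, 0), (-1, 2)],
  [(-1, -1), (1, -1), (1, 0), (0, 1), (-1, 0)],
  [(-1, 0), (0, -1), (1, -1), (1, 0), (0, 1), (-1, 1)],
  [(-1, -1), (2, -1), (0, 1), (-1, 0)],
  [(-1, -1), (1, -1), (1, 0), (0, 1), (-1, 1)],
  [(-1, -1), (3, 1), (-1, 1)],
  [(-1, -1), (1, -1), (1, 1), (-1, 1)],
  [(-1, -1), (2, -1), (0, 1), (-1, 1)],
  [(-1, -1), (2, -1), (-1, 2)]]

/-- The vertices of the duals of the sixteen polygons. -/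
def normals : Fin 16 → List (ℤ × ℤ) := ![
  [(-1, 2), (-1, -1), (2, -1)],
  [(1, 3), (-1, -1), (1, -1)],
  [(-1, 2), (-1, -1), (1, -1), (1, 0)],
  [(1, 1), (-1, 1), (-1, -1), (1, -1)],
  [(-1, 2), (-1, -1), (0, -1), (1, 0)],
  [(0, 1), (-1, 1), (-1, -1), (1, -1), (1, 0)],
  [(-1, 2), (-1, -1), (1, 0)],
  [(1, 1), (-1, 1), (-1, -1), (1, 0)],
  [(0, 1), (-1, 0), (-1, -1), (1, -1), (1, 0)],
  [(1, 1), (0, 1), (-1, 0), (-1, -1), (0, -1), (1, 0)],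
  [(0, 1), (-1, -1), (1, -1), (1, 0)],
  [(0, 1), (-1, 0), (-1, -1), (0, -1), (1, 0)],
  [(-1, 2), (0, -1), (1, 0)],
  [(0, 1), (-1, 0), (0, -1), (1, 0)],
  [(0, 1), (-1, -1), (0, -1), (1, 0)],
  [(0, 1), (-1, -1), (1, 0)]]

/-- A finite certificate that the hulls of `V` and `W` are dual to each other. -/
def DualPair (V W : List (ℤ × ℤ)) : Prop :=
  V ≠ [] ∧ (∀ v ∈ V, ∀ w ∈ W, -1 ≤ ip v w) ∧
  (∀ v ∈ V, ∃ w ∈ W, ip v w = -1 ∧ ∃ w' ∈ W, ip v w' = -1 ∧ dt w w' ≠ 0 ∧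
    (∃ v' ∈ V, ip v' w' = -1 ∧ -1 < ip v' w) ∧ ∃ v' ∈ V, ip v' w = -1 ∧ -1 < ip v' w') ∧
  ∃ a ∈ W, ∃ b ∈ W, ∃ c ∈ W, 0 ≤ dt a b ∧ 0 ≤ dt b c ∧ 0 ≤ dt c a ∧
    0 < dt a b + dt b c + dt c a

instance (V W : List (ℤ × ℤ)) : Decidable (DualPair V W) := by
  unfold DualPair; infer_instance

/-- The matrix with columns `p` and `q` maps every point of `V` into the polygon with
inner normals `W`. -/
def maps (p q : ℤ × ℤ) (V W : List (ℤ × ℤ)) : Bool :=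
  V.all fun v => W.all fun w => decide (-1 ≤ ip w (app p q v))

/-- The lattice points with coordinates between `-1` and `3` of the polygon with inner
normals `W`. -/
def latticePts (W : List (ℤ × ℤ)) : List (ℤ × ℤ) :=
  (([-1, 0, 1, 2, 3] : List ℤ).product [-1, 0, 1, 2, 3]).filter
    fun p => W.all fun w => decide (-1 ≤ ip w p)

theorem dualPair_vertices : ∀ i, DualPair (vertices i) (normals i) := by decide +kernel

theorem dualPair_normals : ∀ i, DualPair (normals i) (vertices i) := by decide +kernel

theorem vertices_mem_box :
    ∀ i, ∀ v ∈ vertices i, (-1 ≤ v.1 ∧ v.1 ≤ 3) ∧ -1 ≤ v.2 ∧ v.2 ≤ 3 := by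
  decide +kernel

theorem unit_mem : ∀ i, ∀ w ∈ normals i, -1 ≤ ip w (1, 0) ∧ -1 ≤ ip w (0, 1) := by
  decide +kernel

/-- The first column of the inverse of the unimodular matrix with columns `p` and `q`. -/
def invFst (p q : ℤ × ℤ) : ℤ × ℤ := (dt p q * q.2, -(dt p q * p.2))

/-- The second column of the inverse of the unimodular matrix with columns `p` and `q`. -/
def invSnd (p q : ℤ × ℤ) : ℤ × ℤ := (-(dt p q * q.1), dt p q * p.1)

theorem not_equiv : ∀ i j : Fin 16, i ≠ j →
    ((latticePts (normals j)).all fun p => (latticePts (normals j)).all fun q =>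
      !((dt p q == 1 || dt p q == -1) && maps p q (vertices i) (normals j) &&
        maps (invFst p q) (invSnd p q) (vertices j) (normals i))) = true := by
  decide +kernel

/-- The nonzero lattice points of the duals of the three minimal polygons. -/
def box : Fin 3 → List (ℤ × ℤ) := ![
  [(-1, -1), (-1, 0), (-1, 1), (-1, 2), (0, -1), (0, 1), (1, -1), (1, 0), (2, -1)],
  [(-1, -1), (-1, 0), (-1, 1), (0, -1), (0, 1), (1, -1), (1, 0), (1, 1)],
  [(-1, -1), (-1, 0), (-1, 1), (0, 1), (1, 0), (1, 1), (2, 1), (3, 1)]]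

/-- The embeddings of the sixteen polygons into the polygon spanned by `B`, where one
embedding is kept for each image. -/
def embeddings (B : List (ℤ × ℤ)) : List (Fin 16 × (ℤ × ℤ) × (ℤ × ℤ)) :=
  (List.finRange 16).flatMap fun i =>
    ((B.product B).filter fun e => (dt e.1 e.2 == 1 || dt e.1 e.2 == -1) &&
      (vertices i).all fun v => B.contains (app e.1 e.2 v)).foldr
        (fun e l => if l.any fun e' => (vertices i).all fun v =>
          ((vertices i).map (app e'.2.1 e'.2.2)).contains (app e.1 e.2 v)
          then l else (i, e) :: l) []

/-- No line through the origin and a point of `S` has all of `S` on one side. -/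
def surrounds (S : List (ℤ × ℤ)) : Bool :=
  S.all fun t => (S.any fun s => decide (dt t s < 0)) && S.any fun s => decide (0 < dt t s)

theorem exists_embedding : ∀ k : Fin 3,
    ((box k).sublists.all fun S => S.isEmpty || !surrounds S || (embeddings (box k)).any fun e =>
      ((vertices e.1).all fun v => S.contains (app e.2.1 e.2.2 v)) &&
        maps (invFst e.2.1 e.2.2) (invSnd e.2.1 e.2.2) S (normals e.1)) = true := by
  decide +kernel

theorem unimodular_of_mem_embeddings {B : List (ℤ × ℤ)} {i : Fin 16} {p q : ℤ × ℤ}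
    (h : (i, p, q) ∈ embeddings B) : dt p q = 1 ∨ dt p q = -1 := by
  rw [embeddings, List.mem_flatMap] at h
  obtain ⟨j, -, h⟩ := h
  set E := (B.product B).filter fun e => (dt e.1 e.2 == 1 || dt e.1 e.2 == -1) &&
    (vertices j).all fun v => B.contains (app e.1 e.2 v) with hE
  have hE' : ∀ e ∈ E, dt e.1 e.2 = 1 ∨ dt e.1 e.2 = -1 := by
    intro e he
    rw [hE, List.mem_filter] at he
    simpa using (Bool.and_eq_true_iff.1 he.2).1
  clear_value E
  clear hE
  induction E with
  | nil => simp at h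
  | cons e l ih =>
    rw [List.foldr_cons] at h
    have ih' := fun h' => ih h' (fun e he => hE' e (List.mem_cons_of_mem _ he))
    split_ifs at h
    · exact ih' h
    · rcases List.mem_cons.1 h with h | h
      · cases h
        exact hE' _ List.mem_cons_self
      · exact ih' h

/-- The lattice points of the dual of the hull of `F`. -/
def InDual (F : Finset (ℤ × ℤ)) (p : ℤ × ℤ) : Prop := ∀ f ∈ F, -1 ≤ ip p f

theorem exists_primitive {s : ℤ × ℤ} (hs : s ≠ 0) :
    ∃ (g : ℤ) (z t : ℤ × ℤ), 0 < g ∧ s = (g * z.1, g * z.2) ∧ dt z t = 1 := by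
  have hg : 0 < Int.gcd s.1 s.2 := by
    rw [Int.gcd_pos_iff]
    by_contra! h
    exact hs (Prod.ext h.1 h.2)
  obtain ⟨a, ha⟩ := Int.gcd_dvd_left s.1 s.2
  obtain ⟨b, hb⟩ := Int.gcd_dvd_right s.1 s.2
  have hg' : (0 : ℤ) < Int.gcd s.1 s.2 := by exact_mod_cast hg
  refine ⟨Int.gcd s.1 s.2, (a, b), (-Int.gcdB s.1 s.2, Int.gcdA s.1 s.2), hg',
    Prod.ext ha hb, ?_⟩
  have h := Int.gcd_eq_gcd_ab s.1 s.2
  generalize Int.gcdA s.1 s.2 = x at *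
  generalize Int.gcdB s.1 s.2 = y at *
  generalize (Int.gcd s.1 s.2 : ℤ) = g at *
  simp only [dt]
  rw [ha, hb] at h
  apply mul_left_cancel₀ hg'.ne'
  linear_combination -h

theorem InDual.of_mul {F : Finset (ℤ × ℤ)} {g : ℤ} {z : ℤ × ℤ} (hg : 0 < g)
    (h : InDual F (g * z.1, g * z.2)) : InDual F z := by
  intro f hf
  have := h f hf
  simp only [ip] at *
  by_contra! hlt
  nlinarith

/-- Two lattice points on opposite rays give an antipodal pair of primitive points. -/
theorem exists_antipodal {F : Finset (ℤ × ℤ)} {s r x : ℤ × ℤ} (hs : InDual F s)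
    (hr : InDual F r) (h0 : dt s r = 0) (hxr : dt x r < 0) (hxs : 0 < dt x s) :
    ∃ z t : ℤ × ℤ, dt z t = 1 ∧ InDual F z ∧ InDual F (-z) := by
  obtain ⟨g, z, t, hg, rfl, hzt⟩ := exists_primitive (s := s) (by
    rintro rfl
    simp [dt] at hxs)
  refine ⟨z, t, hzt, hs.of_mul hg, fun f hf => ?_⟩
  have hz : dt z r = 0 := by
    apply mul_left_cancel₀ hg.ne'
    simp only [dt] at *
    linear_combination h0
  have hxz : 0 < dt x z := by
    have : dt x (g * z.1, g * z.2) = g * dt x z := by simp only [dt]; ring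
    rw [this] at hxs
    exact pos_of_mul_pos_right hxs hg.le
  have h1 : dt x r = dt r t * dt x z := by
    simp only [dt] at *
    linear_combination (-(x.1 * r.2 - x.2 * r.1)) * hzt + (x.1 * t.2 - x.2 * t.1) * hz
  have h2 : ip r f = dt r t * ip z f := by
    simp only [dt, ip] at *
    linear_combination (-(r.1 * f.1 + r.2 * f.2)) * hzt + (t.1 * f.1 + t.2 * f.2) * hz
  have hc : dt r t < 0 := by
    rw [h1] at hxr
    exact neg_of_mul_neg_left hxr hxz.le
  have h3 := hr f hf
  rw [h2] at h3
  have h4 : ip (-z) f = -ip z f := by simp only [ip, Prod.fst_neg, Prod.snd_neg]; ring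
  rw [h4]
  by_contra! hlt
  nlinarith

/-- A triangle around the origin with a non-unimodular edge cone can be made smaller, unless
there is an antipodal pair. -/
theorem exists_smaller_triangle {F : Finset (ℤ × ℤ)} {p q r : ℤ × ℤ} (hp : InDual F p)
    (hq : InDual F q) (hr : InDual F r) (hpq : 2 ≤ dt p q) (hqr : 0 < dt q r)
    (hrp : 0 < dt r p) :
    (∃ p' q' r' : ℤ × ℤ, InDual F p' ∧ InDual F q' ∧ InDual F r' ∧ 0 < dt p' q' ∧
      0 < dt q' r' ∧ 0 < dt r' p' ∧
      dt p' q' + dt q' r' + dt r' p' < dt p q + dt q r + dt r p) ∨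
    ∃ z t : ℤ × ℤ, dt z t = 1 ∧ InDual F z ∧ InDual F (-z) := by
  obtain ⟨g, z, t, hg, rfl, hzt⟩ := exists_primitive (s := p) (by
    rintro rfl
    simp [dt] at hpq)
  have hz := hp.of_mul hg
  have e1 : dt (g * z.1, g * z.2) q = g * dt z q := by simp only [dt]; ring
  have e2 : dt r (g * z.1, g * z.2) = g * dt r z := by simp only [dt]; ring
  rw [e1] at hpq ⊢
  rw [e2] at hrp ⊢
  have hzq : 0 < dt z q := pos_of_mul_pos_right (by linarith) hg.le
  have hrz : 0 < dt r z := pos_of_mul_pos_right hrp hg.le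
  rcases (show 1 ≤ g from hg).eq_or_lt with rfl | hg2
  swap
  · exact Or.inl ⟨z, q, r, hz, hq, hr, hzq, hqr, hrz, by nlinarith⟩
  rw [one_mul] at hpq hrp ⊢
  rw [one_mul]
  set d := dt z q with hd
  obtain ⟨s, hzs, hs0, hsd⟩ : ∃ s : ℤ × ℤ, dt z s = 1 ∧ 0 ≤ dt s q ∧ dt s q < d := by
    refine ⟨(t.1 - dt t q / d * z.1, t.2 - dt t q / d * z.2), ?_, ?_⟩
    · simp only [dt] at *
      linear_combination hzt
    · have : dt (t.1 - dt t q / d * z.1, t.2 - dt t q / d * z.2) q = dt t q % d := by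
        rw [Int.emod_def, hd]
        simp only [dt]
        ring
      rw [this]
      exact ⟨Int.emod_nonneg _ (by omega), Int.emod_lt_of_pos _ (by omega)⟩
  have key : ∀ f, d * ip s f = dt s q * ip z f + ip q f := by
    intro f
    rw [hd]
    simp only [dt, ip] at *
    linear_combination (q.1 * f.1 + q.2 * f.2) * hzs
  have key2 : d * dt s r = dt q r - dt s q * dt r z := by
    rw [hd]
    simp only [dt] at *
    linear_combination (q.1 * r.2 - q.2 * r.1) * hzs
  have hs : InDual F s := by
    intro f hf
    have h1 := hz f hf
    have h2 := hq f hf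
    have h3 := key f
    by_contra! hlt
    nlinarith
  rcases lt_trichotomy (dt s r) 0 with h | h | h
  · refine Or.inl ⟨s, q, r, hs, hq, hr, ?_, hqr, ?_, ?_⟩
    · by_contra! hle
      have : dt s q = 0 := le_antisymm hle hs0
      rw [this] at key2
      nlinarith
    · simp only [dt] at *
      linarith
    · have h1 : dt r s = -dt s r := by simp only [dt]; ring
      rw [h1]
      nlinarith
  · exact Or.inr (exists_antipodal hs hr h
      (by have h1 : dt z r = -dt r z := by simp only [dt]; ring
          linarith) (by rw [hzs]; exact one_pos))
  · refine Or.inl ⟨z, s, r, hz, hs, hr, by omega, h, hrz, ?_⟩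
    have : dt s r ≤ dt q r := by nlinarith
    omega

theorem exists_triple_or_antipodal {F : Finset (ℤ × ℤ)} (n : ℕ) : ∀ {p q r : ℤ × ℤ},
    InDual F p → InDual F q → InDual F r → 0 < dt p q → 0 < dt q r → 0 < dt r p →
    dt p q + dt q r + dt r p ≤ n →
    (∃ p q : ℤ × ℤ, dt p q = 1 ∧ InDual F p ∧ InDual F q ∧ InDual F (-p - q)) ∨
    ∃ z t : ℤ × ℤ, dt z t = 1 ∧ InDual F z ∧ InDual F (-z) := by
  induction n with
  | zero => intros; omega
  | succ n ih =>
    intro p q r hp hq hr h1 h2 h3 hn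
    push_cast at hn
    by_cases c1 : 2 ≤ dt p q
    · obtain ⟨p', q', r', hp', hq', hr', h1', h2', h3', hlt⟩ | h :=
        exists_smaller_triangle hp hq hr c1 h2 h3
      · exact ih hp' hq' hr' h1' h2' h3' (by omega)
      · exact Or.inr h
    by_cases c2 : 2 ≤ dt q r
    · obtain ⟨p', q', r', hp', hq', hr', h1', h2', h3', hlt⟩ | h :=
        exists_smaller_triangle hq hr hp c2 h3 h1
      · exact ih hp' hq' hr' h1' h2' h3' (by omega)
      · exact Or.inr h
    by_cases c3 : 2 ≤ dt r p
    · obtain ⟨p', q', r', hp', hq', hr', h1', h2', h3', hlt⟩ | h :=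
        exists_smaller_triangle hr hp hq c3 h1 h2
      · exact ih hp' hq' hr' h1' h2' h3' (by omega)
      · exact Or.inr h
    have d1 : dt p q = 1 := by omega
    have d2 : dt q r = 1 := by omega
    have d3 : dt r p = 1 := by omega
    refine Or.inl ⟨p, q, d1, hp, hq, ?_⟩
    convert hr using 1
    simp only [dt] at *
    ext
    · simp only [Prod.fst_sub, Prod.fst_neg]
      linear_combination p.1 * d2 + q.1 * d3 + r.1 * d1
    · simp only [Prod.snd_sub, Prod.snd_neg]
      linear_combination p.2 * d2 + q.2 * d3 + r.2 * d1

/-- A set of lattice points of the dual surrounding the origin contains a triangle around the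
origin or two opposite points. -/
theorem exists_triangle_or_antipodal {F G : Finset (ℤ × ℤ)}
    (hG : ∀ u : ℤ × ℤ, u ≠ 0 → ∃ g ∈ G, ip g u < 0) (hFG : ∀ g ∈ G, InDual F g) :
    (∃ p q r : ℤ × ℤ, InDual F p ∧ InDual F q ∧ InDual F r ∧
      0 < dt p q ∧ 0 < dt q r ∧ 0 < dt r p) ∨
    ∃ z t : ℤ × ℤ, dt z t = 1 ∧ InDual F z ∧ InDual F (-z) := by
  have turn : ∀ p : ℤ × ℤ, p ≠ 0 → ∃ g ∈ G, 0 < dt p g := by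
    intro p hp
    obtain ⟨g, hg, h⟩ := hG (p.2, -p.1) (by
      intro h
      apply hp
      simp only [Prod.mk_eq_zero, neg_eq_zero] at h
      exact Prod.ext h.2 h.1)
    refine ⟨g, hg, ?_⟩
    simp only [ip, dt] at *
    linarith
  obtain ⟨p, hpG, hp⟩ := hG (1, 0) (by simp)
  have hp0 : p ≠ 0 := by
    rintro rfl
    simp [ip] at hp
  obtain ⟨q₀, hq₀, hpq₀⟩ := turn p hp0
  obtain ⟨q, hqm, hmin⟩ := (G.filter fun g => 0 < dt p g).exists_min_image
    (fun g => (ip p g : ℚ) / dt p g) ⟨q₀, Finset.mem_filter.2 ⟨hq₀, hpq₀⟩⟩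
  obtain ⟨hqG, hpq⟩ := Finset.mem_filter.1 hqm
  obtain ⟨r, hrG, hqr⟩ := turn q (by
    rintro rfl
    simp [dt] at hpq)
  have hswap : dt r p = -dt p r := by simp only [dt]; ring
  rcases lt_trichotomy (dt p r) 0 with h | h | h
  · exact Or.inl ⟨p, q, r, hFG p hpG, hFG q hqG, hFG r hrG, hpq, hqr, by omega⟩
  · refine Or.inr (exists_antipodal (x := (-q)) (hFG p hpG) (hFG r hrG) h ?_ ?_)
    · simp only [dt, Prod.fst_neg, Prod.snd_neg] at *
      linarith
    · simp only [dt, Prod.fst_neg, Prod.snd_neg] at *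
      linarith
  · exfalso
    have h1 := hmin r (Finset.mem_filter.2 ⟨hrG, h⟩)
    rw [div_le_div_iff₀ (by exact_mod_cast hpq) (by exact_mod_cast h)] at h1
    have h2 : ip p q * dt p r ≤ ip p r * dt p q := by exact_mod_cast h1
    have h3 : ip p q * dt p r - ip p r * dt p q = ip p p * dt q r := by
      simp only [ip, dt]; ring
    have h4 : 0 < ip p p := by
      simp only [ip] at *
      have : p.1 ≠ 0 := by
        intro h0
        simp [h0] at hp
      have := mul_self_pos.2 this
      nlinarith [mul_self_nonneg p.2]
    nlinarith

theorem exists_slice {F : Finset (ℤ × ℤ)} {s t g : ℤ × ℤ} (hs : InDual F s)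
    (hs' : InDual F (-s)) (ht : dt t s = 1) (hg : InDual F g) (hgs : 0 < dt g s) :
    ∃ k : ℤ, InDual F (t.1 + k * s.1, t.2 + k * s.2) := by
  set a := dt g s with ha
  set b := dt t g with hb
  refine ⟨-(-b / a), fun f hf => ?_⟩
  have h0 := Int.emod_nonneg (-b) hgs.ne'
  have h1 := Int.emod_lt_of_pos (-b) hgs
  rw [Int.emod_def] at h0 h1
  set k := -b / a
  have h2 := hs f hf
  have h3 := hs' f hf
  have h4 := hg f hf
  have h5 : ip (-s) f = -ip s f := by simp only [ip, Prod.fst_neg, Prod.snd_neg]; ring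
  have h6 : a * ip (t.1 + -k * s.1, t.2 + -k * s.2) f = ip g f + (-b - a * k) * ip s f := by
    rw [ha, hb]
    simp only [dt, ip] at *
    linear_combination (g.1 * f.1 + g.2 * f.2) * ht
  rw [h5] at h3
  by_contra! hlt
  nlinarith

/-- Up to unimodular transformations, the dual contains one of the three minimal polygons. -/
theorem exists_frame {F G : Finset (ℤ × ℤ)}
    (hF : ∀ u : ℤ × ℤ, u ≠ 0 → ∃ f ∈ F, ip f u < 0)
    (hG : ∀ u : ℤ × ℤ, u ≠ 0 → ∃ g ∈ G, ip g u < 0) (hFG : ∀ g ∈ G, InDual F g) :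
    ∃ p q : ℤ × ℤ, (dt p q = 1 ∨ dt p q = -1) ∧ InDual F p ∧ InDual F q ∧
      (InDual F (-p - q) ∨ InDual F (-q) ∧
        (InDual F (-p) ∨ InDual F (-p + 2 * q))) := by
  have finish : ∀ (p s : ℤ × ℤ) (l : ℤ), 0 ≤ l → (dt p s = 1 ∨ dt p s = -1) → InDual F p →
      InDual F s → InDual F (-s) → InDual F (-p.1 + l * s.1, -p.2 + l * s.2) →
      ∃ p q : ℤ × ℤ, (dt p q = 1 ∨ dt p q = -1) ∧ InDual F p ∧ InDual F q ∧
      (InDual F (-p - q) ∨ InDual F (-q) ∧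
        (InDual F (-p) ∨ InDual F (-p + 2 * q))) := by
    intro p s l hl hps hp hs hs' h
    have hl2 : l ≤ 2 := by
      by_contra! hlt
      obtain ⟨f, hf, hsf⟩ := hF s (by
        rintro rfl
        simp [dt] at hps)
      have h1 := hp f hf
      have h2 := hs f hf
      have h3 := h f hf
      simp only [ip] at *
      nlinarith
    interval_cases l
    · refine ⟨p, s, hps, hp, hs, Or.inr ⟨hs', Or.inl ?_⟩⟩
      convert h using 1
      ext <;> simp
    · refine ⟨p, -s, ?_, hp, hs', Or.inl ?_⟩
      · simp only [dt, Prod.fst_neg, Prod.snd_neg] at *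
        rcases hps with h | h
        · exact Or.inr (by linarith)
        · exact Or.inl (by linarith)
      · convert h using 1
        ext <;> simp
    · refine ⟨p, s, hps, hp, hs, Or.inr ⟨hs', Or.inr ?_⟩⟩
      exact h
  have key : (∃ p q : ℤ × ℤ, dt p q = 1 ∧ InDual F p ∧ InDual F q ∧ InDual F (-p - q)) ∨
      ∃ z t : ℤ × ℤ, dt z t = 1 ∧ InDual F z ∧ InDual F (-z) := by
    obtain ⟨p, q, r, hp, hq, hr, h1, h2, h3⟩ | h := exists_triangle_or_antipodal hG hFG
    · exact exists_triple_or_antipodal (dt p q + dt q r + dt r p).toNat hp hq hr h1 h2 h3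
        (by omega)
    · exact Or.inr h
  obtain ⟨p, q, h1, hp, hq, hr⟩ | ⟨s, t, hst, hs, hs'⟩ := key
  · exact ⟨p, q, Or.inl h1, hp, hq, Or.inl hr⟩
  have side : ∀ u : ℤ × ℤ, u ≠ 0 → ∃ g ∈ G, 0 < dt g u := by
    intro u hu
    obtain ⟨g, hg, h⟩ := hG (-u.2, u.1) (by
      intro h
      apply hu
      simp only [Prod.mk_eq_zero, neg_eq_zero] at h
      exact Prod.ext h.2 h.1)
    refine ⟨g, hg, ?_⟩
    simp only [ip, dt] at *
    linarith
  have hs0 : s ≠ 0 := by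
    rintro rfl
    simp [dt] at hst
  obtain ⟨g₁, hg₁, hd₁⟩ := side s hs0
  obtain ⟨g₂, hg₂, hd₂⟩ := side (-s) (by simpa using hs0)
  obtain ⟨k, hk⟩ := exists_slice (t := -t) hs hs' (by
    simp only [dt, Prod.fst_neg, Prod.snd_neg] at *; linarith) (hFG _ hg₁) hd₁
  obtain ⟨m, hm⟩ := exists_slice (t := t) hs' (by simpa using hs) (by
    simp only [dt, Prod.fst_neg, Prod.snd_neg] at *; linarith) (hFG _ hg₂) hd₂
  have hdet : dt ((-t).1 + k * s.1, (-t).2 + k * s.2) s = 1 := by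
    simp only [dt, Prod.fst_neg, Prod.snd_neg] at *
    linear_combination hst
  rcases le_total 0 (k - m) with h | h
  · refine finish _ s (k - m) h (Or.inl hdet) hk hs hs' ?_
    convert hm using 2 <;> simp only [Prod.fst_neg, Prod.snd_neg] <;> ring
  · refine finish _ (-s) (m - k) (by omega) (Or.inr ?_) hk hs' (by simpa using hs) ?_
    · simp only [dt, Prod.fst_neg, Prod.snd_neg] at *
      linear_combination -hdet
    · convert hm using 2 <;> simp only [Prod.fst_neg, Prod.snd_neg] <;> ring

/-- The real vector with the given integer coordinates. -/
def toR (v : ℤ × ℤ) : Fin 2 → ℝ := ![(v.1 : ℝ), (v.2 : ℝ)]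

/-- The convex hull in the real plane of a set of lattice points. -/
def hull (S : Set (ℤ × ℤ)) : Set (Fin 2 → ℝ) := convexHull ℝ (toR '' S)

theorem isLatticePolytope_iff {s : Set (Fin 2 → ℝ)} :
    IsLatticePolytope s ↔ ∃ F : Finset (ℤ × ℤ), s = hull F := by
  constructor
  · rintro ⟨F, hfin, hF, rfl⟩
    have hinj : Function.Injective toR := by
      intro u v h
      have h0 := congrFun h 0
      have h1 := congrFun h 1
      simp only [toR, Matrix.cons_val_zero, Matrix.cons_val_one, Int.cast_inj] at h0 h1
      exact Prod.ext h0 h1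
    refine ⟨(hfin.preimage hinj.injOn).toFinset, ?_⟩
    rw [hull, Set.Finite.coe_toFinset, Set.image_preimage_eq_of_subset]
    intro x hx
    obtain ⟨a, ha⟩ := hF x hx 0
    obtain ⟨b, hb⟩ := hF x hx 1
    refine ⟨(a, b), ?_⟩
    ext i
    fin_cases i
    · exact ha.symm
    · exact hb.symm
  · rintro ⟨F, rfl⟩
    refine ⟨toR '' F, F.finite_toSet.image _, ?_, rfl⟩
    rintro _ ⟨v, -, rfl⟩ i
    fin_cases i
    · exact ⟨v.1, rfl⟩
    · exact ⟨v.2, rfl⟩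

theorem convex_dualSet {n : ℕ} (s : Set (Fin n → ℝ)) : Convex ℝ (dualSet s) := by
  intro x hx y hy a b ha hb hab z hz
  have h1 := hx z hz
  have h2 := hy z hz
  have : ∑ i, (a • x + b • y) i * z i = a * ∑ i, x i * z i + b * ∑ i, y i * z i := by
    simp only [Finset.mul_sum, ← Finset.sum_add_distrib]
    refine Finset.sum_congr rfl fun i _ => ?_
    simp only [Pi.add_apply, Pi.smul_apply, smul_eq_mul]
    ring
  rw [this]
  nlinarith

theorem le_of_mem_hull {S : Set (ℤ × ℤ)} {c : ℝ} {y : Fin 2 → ℝ}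
    (h : ∀ v ∈ S, c ≤ y 0 * v.1 + y 1 * v.2) {x : Fin 2 → ℝ} (hx : x ∈ hull S) :
    c ≤ y 0 * x 0 + y 1 * x 1 := by
  have hconv : Convex ℝ {x : Fin 2 → ℝ | c ≤ y 0 * x 0 + y 1 * x 1} := by
    intro a ha b hb s t hs ht hst
    simp only [Set.mem_ofPred_eq, Pi.add_apply, Pi.smul_apply, smul_eq_mul] at *
    have : c = s * c + t * c := by rw [← add_mul, hst, one_mul]
    nlinarith
  refine convexHull_min ?_ hconv hx
  rintro _ ⟨v, hv, rfl⟩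
  exact h v hv

theorem toR_mem_hull {S : Set (ℤ × ℤ)} {v : ℤ × ℤ} (hv : v ∈ S) : toR v ∈ hull S :=
  subset_convexHull ℝ _ ⟨v, hv, rfl⟩

theorem mem_dualSet_hull {S : Set (ℤ × ℤ)} {y : Fin 2 → ℝ} :
    y ∈ dualSet (hull S) ↔ ∀ v ∈ S, -1 ≤ y 0 * v.1 + y 1 * v.2 := by
  constructor
  · intro h v hv
    simpa [Fin.sum_univ_two, toR] using h (toR v) (toR_mem_hull hv)
  · intro h x hx
    rw [Fin.sum_univ_two]
    exact le_of_mem_hull h hx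

theorem toR_mem_dualSet_hull {S : Set (ℤ × ℤ)} {p : ℤ × ℤ} :
    toR p ∈ dualSet (hull S) ↔ ∀ v ∈ S, -1 ≤ ip p v := by
  rw [mem_dualSet_hull]
  refine forall₂_congr fun v _ => ?_
  simp only [toR, ip, Matrix.cons_val_zero, Matrix.cons_val_one]
  exact_mod_cast Iff.rfl

theorem combo_mem {s : Set (Fin 2 → ℝ)} (hs : Convex ℝ s) {x y z : Fin 2 → ℝ} (hx : x ∈ s)
    (hy : y ∈ s) (hz : z ∈ s) {a b c : ℝ} (ha : 0 ≤ a) (hb : 0 ≤ b) (hc : 0 ≤ c)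
    (habc : a + b + c = 1) : a • x + b • y + c • z ∈ s := by
  have := hs.sum_mem (t := Finset.univ) (w := ![a, b, c]) (z := ![x, y, z])
    (by intro i _; fin_cases i <;> assumption) (by simpa [Fin.sum_univ_three] using habc)
    (by intro i _; fin_cases i <;> assumption)
  simpa [Fin.sum_univ_three] using this

theorem DualPair.zero_mem {V W : List (ℤ × ℤ)} (h : DualPair V W) :
    (0 : Fin 2 → ℝ) ∈ hull {w | w ∈ W} := by
  obtain ⟨-, -, -, a, ha, b, hb, c, hc, h1, h2, h3, h4⟩ := h
  set n := dt a b + dt b c + dt c a with hn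
  have hn0 : (0 : ℝ) < n := by exact_mod_cast h4
  have := combo_mem (s := hull {w | w ∈ W}) (convex_convexHull ℝ _)
    (toR_mem_hull (S := {w | w ∈ W}) ha)
    (toR_mem_hull (S := {w | w ∈ W}) hb) (toR_mem_hull (S := {w | w ∈ W}) hc)
    (a := (dt b c : ℝ) / n) (b := (dt c a : ℝ) / n) (c := (dt a b : ℝ) / n)
    (div_nonneg (by exact_mod_cast h2) hn0.le) (div_nonneg (by exact_mod_cast h3) hn0.le)
    (div_nonneg (by exact_mod_cast h1) hn0.le) (by
      rw [← add_div, ← add_div, div_eq_one_iff_eq hn0.ne', hn]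
      push_cast
      ring)
  convert this using 1
  ext i
  fin_cases i
  · simp [toR, dt]
    field_simp
    ring
  · simp [toR, dt]
    field_simp
    ring

theorem DualPair.dualSet_hull {V W : List (ℤ × ℤ)} (h : DualPair V W) :
    dualSet (hull {v | v ∈ V}) = hull {w | w ∈ W} := by
  have h0 := h.zero_mem
  obtain ⟨hV, hVW, hedge, -⟩ := h
  refine Set.Subset.antisymm ?_ (convexHull_min ?_ (convex_dualSet _))
  swap
  · rintro _ ⟨w, hw, rfl⟩
    rw [toR_mem_dualSet_hull]
    intro v hv
    have := hVW v hv w hw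
    simp only [ip] at *
    linarith
  intro y hy
  rw [mem_dualSet_hull] at hy
  obtain ⟨v, hv, hmin⟩ := V.toFinset.exists_min_image
    (fun v => y 0 * v.1 + y 1 * v.2) (by simpa [List.toFinset_nonempty_iff] using hV)
  rw [List.mem_toFinset] at hv
  obtain ⟨w, hw, e1, w', hw', e2, hd, ⟨a, ha, e3, e4⟩, b, hb, e5, e6⟩ := hedge v hv
  have hya := hmin a (List.mem_toFinset.2 ha)
  have hyb := hmin b (List.mem_toFinset.2 hb)
  have hyv := hy v hv
  have hd' : (dt w w' : ℝ) ≠ 0 := by exact_mod_cast hd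
  obtain ⟨α, β, hy0, hy1⟩ : ∃ α β : ℝ, y 0 = α * w.1 + β * w'.1 ∧ y 1 = α * w.2 + β * w'.2 := by
    refine ⟨(y 0 * w'.2 - y 1 * w'.1) / dt w w', (w.1 * y 1 - w.2 * y 0) / dt w w', ?_, ?_⟩ <;>
    · field_simp
      simp only [dt]
      push_cast
      ring
  rw [hy0, hy1] at hya hyb hyv
  simp only [ip] at e1 e2 e3 e4 e5 e6
  have e1' : (v.1 * w.1 + v.2 * w.2 : ℝ) = -1 := by exact_mod_cast e1
  have e2' : (v.1 * w'.1 + v.2 * w'.2 : ℝ) = -1 := by exact_mod_cast e2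
  have e3' : (a.1 * w'.1 + a.2 * w'.2 : ℝ) = -1 := by exact_mod_cast e3
  have e4' : (-1 : ℝ) < a.1 * w.1 + a.2 * w.2 := by exact_mod_cast e4
  have e5' : (b.1 * w.1 + b.2 * w.2 : ℝ) = -1 := by exact_mod_cast e5
  have e6' : (-1 : ℝ) < b.1 * w'.1 + b.2 * w'.2 := by exact_mod_cast e6
  have hpair : ∀ u : ℤ × ℤ, (α * w.1 + β * w'.1) * u.1 + (α * w.2 + β * w'.2) * u.2 =
      α * (u.1 * w.1 + u.2 * w.2) + β * (u.1 * w'.1 + u.2 * w'.2) := fun u => by ring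
  rw [hpair, hpair, e1', e2'] at hya hyb
  rw [hpair, e1', e2'] at hyv
  rw [e3'] at hya
  rw [e5'] at hyb
  have hα : 0 ≤ α := by
    by_contra! hlt
    nlinarith
  have hβ : 0 ≤ β := by
    by_contra! hlt
    nlinarith
  have hαβ : α + β ≤ 1 := by linarith
  have := combo_mem (s := hull {w | w ∈ W}) (convex_convexHull ℝ _)
    (toR_mem_hull (S := {w | w ∈ W}) hw)
    (toR_mem_hull (S := {w | w ∈ W}) hw') h0 hα hβ (sub_nonneg.2 hαβ) (by ring)
  convert this using 1
  ext i
  fin_cases i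
  · simpa [toR] using hy0
  · simpa [toR] using hy1

theorem _root_.GLZEquiv.trans {n : ℕ} {s t u : Set (Fin n → ℝ)} (h : GLZEquiv s t)
    (h' : GLZEquiv t u) : GLZEquiv s u := by
  obtain ⟨A, hA, rfl⟩ := h
  obtain ⟨B, hB, rfl⟩ := h'
  refine ⟨B * A, by rw [Matrix.det_mul]; exact hB.mul hA, ?_⟩
  rw [Set.image_image]
  refine Set.image_congr fun x _ => ?_
  have : (B * A).map ((↑) : ℤ → ℝ) = B.map (↑) * A.map (↑) :=
    Matrix.map_mul (f := Int.castRingHom ℝ)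
  rw [this, Matrix.mulVec_mulVec]

theorem _root_.GLZEquiv.symm {n : ℕ} {s t : Set (Fin n → ℝ)} (h : GLZEquiv s t) : GLZEquiv t s := by
  obtain ⟨A, hA, rfl⟩ := h
  refine ⟨A⁻¹, ?_, ?_⟩
  · exact (Matrix.isUnit_nonsing_inv_det_iff).2 hA
  rw [Set.image_image]
  have : (A⁻¹).map ((↑) : ℤ → ℝ) * A.map (↑) = 1 := by
    have h := Matrix.map_mul (f := Int.castRingHom ℝ) (L := A⁻¹) (M := A)
    rw [Matrix.nonsing_inv_mul A hA] at h
    have h' : (1 : Matrix (Fin n) (Fin n) ℤ).map (Int.castRingHom ℝ) = 1 :=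
      Matrix.map_one _ (map_zero _) (map_one _)
    rw [h'] at h
    exact h.symm
  simp only [Matrix.mulVec_mulVec, this, Matrix.one_mulVec, Set.image_id']

theorem mulVec_toR (A : Matrix (Fin 2) (Fin 2) ℤ) (v : ℤ × ℤ) :
    (A.map ((↑) : ℤ → ℝ)).mulVec (toR v) = toR (app (A 0 0, A 1 0) (A 0 1, A 1 1) v) := by
  ext i
  fin_cases i <;>
    simp [Matrix.mulVec, dotProduct, Fin.sum_univ_two, toR, app]

theorem image_hull (A : Matrix (Fin 2) (Fin 2) ℤ) (S : Set (ℤ × ℤ)) :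
    (fun x => (A.map ((↑) : ℤ → ℝ)).mulVec x) '' hull S =
      hull (app (A 0 0, A 1 0) (A 0 1, A 1 1) '' S) := by
  have h := (Matrix.mulVecLin (A.map ((↑) : ℤ → ℝ))).image_convexHull (toR '' S)
  rw [hull, hull, Set.image_image]
  simp only [← mulVec_toR]
  rw [← Set.image_image (fun x => (A.map ((↑) : ℤ → ℝ)).mulVec x) toR]
  exact h

theorem glzEquiv_hull {p q : ℤ × ℤ} (h : dt p q = 1 ∨ dt p q = -1) (S : Set (ℤ × ℤ)) :
    GLZEquiv (hull S) (hull (app p q '' S)) := by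
  refine ⟨!![p.1, q.1; p.2, q.2], ?_, ?_⟩
  · rw [Int.isUnit_iff, Matrix.det_fin_two_of]
    simp only [dt] at h
    rwa [mul_comm q.1]
  · rw [image_hull]
    rfl

theorem app_inv {p q : ℤ × ℤ} (h : dt p q = 1 ∨ dt p q = -1) (v : ℤ × ℤ) :
    app p q (app (invFst p q) (invSnd p q) v) = v := by
  have : dt p q * dt p q = 1 := by rcases h with h | h <;> rw [h] <;> rfl
  simp only [app, invFst, invSnd]
  generalize hd : dt p q = d at *
  simp only [dt] at hd
  ext
  · linear_combination v.1 * this + v.1 * d * hd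
  · linear_combination v.2 * this + v.2 * d * hd

theorem inv_app {p q : ℤ × ℤ} (h : dt p q = 1 ∨ dt p q = -1) (v : ℤ × ℤ) :
    app (invFst p q) (invSnd p q) (app p q v) = v := by
  have : dt p q * dt p q = 1 := by rcases h with h | h <;> rw [h] <;> rfl
  simp only [app, invFst, invSnd]
  generalize hd : dt p q = d at *
  simp only [dt] at hd
  ext
  · linear_combination v.1 * this + v.1 * d * hd
  · linear_combination v.2 * this + v.2 * d * hd

/-- The sixteen reflexive polygons. -/
def polygon (i : Fin 16) : Set (Fin 2 → ℝ) := hull {v | v ∈ vertices i}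

theorem dualSet_polygon (i : Fin 16) : dualSet (polygon i) = hull {w | w ∈ normals i} :=
  (dualPair_vertices i).dualSet_hull

theorem polygon_eq (i : Fin 16) : polygon i = dualSet (hull {w | w ∈ normals i}) :=
  (dualPair_normals i).dualSet_hull.symm

theorem toR_mem_polygon {i : Fin 16} {p : ℤ × ℤ} :
    toR p ∈ polygon i ↔ ∀ w ∈ normals i, -1 ≤ ip w p := by
  rw [polygon_eq, toR_mem_dualSet_hull]
  refine forall₂_congr fun w _ => ?_
  rw [ip, ip, mul_comm, mul_comm p.2]

theorem isLatticePolytope_hull (V : List (ℤ × ℤ)) : IsLatticePolytope (hull {v | v ∈ V}) :=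
  isLatticePolytope_iff.2 ⟨V.toFinset, by rw [List.coe_toFinset]⟩

theorem zero_mem_interior_dualSet (F : Finset (ℤ × ℤ)) :
    (0 : Fin 2 → ℝ) ∈ interior (dualSet (hull F)) := by
  rw [mem_interior]
  refine ⟨⋂ w ∈ F, {y | -1 < y 0 * w.1 + y 1 * w.2}, ?_, ?_, ?_⟩
  · intro y hy
    rw [mem_dualSet_hull]
    intro w hw
    simp only [Set.mem_iInter] at hy
    exact (hy w hw).le
  · refine isOpen_biInter_finset fun w _ => ?_
    exact isOpen_lt continuous_const (by fun_prop)
  · simp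

theorem isReflexive_polygon (i : Fin 16) : IsReflexive (polygon i) := by
  refine ⟨isLatticePolytope_hull _, ?_, ?_⟩
  · have h := zero_mem_interior_dualSet (normals i).toFinset
    rwa [List.coe_toFinset, ← polygon_eq] at h
  · rw [dualSet_polygon]
    exact isLatticePolytope_hull _

theorem mem_latticePts {i : Fin 16} {p : ℤ × ℤ} (hp : toR p ∈ polygon i) :
    p ∈ latticePts (normals i) := by
  have hbox := vertices_mem_box i
  have h1 : (-1 : ℝ) ≤ p.1 := by
    simpa [toR] using le_of_mem_hull (c := -1) (y := ![1, 0])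
      (fun v hv => by
        have : (-1 : ℝ) ≤ v.1 := by exact_mod_cast (hbox v hv).1.1
        simpa using this) hp
  have h2 : (-1 : ℝ) ≤ p.2 := by
    simpa [toR] using le_of_mem_hull (c := -1) (y := ![0, 1])
      (fun v hv => by
        have : (-1 : ℝ) ≤ v.2 := by exact_mod_cast (hbox v hv).2.1
        simpa using this) hp
  have h3 : (p.1 : ℝ) ≤ 3 := by
    simpa [toR] using le_of_mem_hull (c := -3) (y := ![-1, 0])
      (fun v hv => by
        have : (v.1 : ℝ) ≤ 3 := by exact_mod_cast (hbox v hv).1.2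
        simpa using this) hp
  have h4 : (p.2 : ℝ) ≤ 3 := by
    simpa [toR] using le_of_mem_hull (c := -3) (y := ![0, -1])
      (fun v hv => by
        have : (v.2 : ℝ) ≤ 3 := by exact_mod_cast (hbox v hv).2.2
        simpa using this) hp
  have k1 : -1 ≤ p.1 := by exact_mod_cast h1
  have k2 : -1 ≤ p.2 := by exact_mod_cast h2
  have k3 : p.1 ≤ 3 := by exact_mod_cast h3
  have k4 : p.2 ≤ 3 := by exact_mod_cast h4
  have mem : ∀ x : ℤ, -1 ≤ x → x ≤ 3 → x ∈ ([-1, 0, 1, 2, 3] : List ℤ) := by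
    intro x hx hx'
    interval_cases x <;> decide
  rw [latticePts, List.mem_filter, List.all_eq_true]
  refine ⟨List.mem_product.2 ⟨mem _ k1 k3, mem _ k2 k4⟩, fun w hw => ?_⟩
  exact decide_eq_true (toR_mem_polygon.1 hp w hw)

theorem maps_of_subset {p q : ℤ × ℤ} {i j : Fin 16}
    (h : hull (app p q '' {v | v ∈ vertices i}) ⊆ polygon j) :
    maps p q (vertices i) (normals j) = true := by
  simp only [maps, List.all_eq_true, decide_eq_true_eq]
  intro v hv
  exact toR_mem_polygon.1 (h (toR_mem_hull ⟨v, hv, rfl⟩))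

theorem not_glzEquiv_polygon {i j : Fin 16} (hij : i ≠ j) :
    ¬ GLZEquiv (polygon i) (polygon j) := by
  rintro ⟨A, hA, h⟩
  set p : ℤ × ℤ := (A 0 0, A 1 0) with hp
  set q : ℤ × ℤ := (A 0 1, A 1 1) with hq
  have hd : dt p q = 1 ∨ dt p q = -1 := by
    rw [Int.isUnit_iff, Matrix.det_fin_two] at hA
    simp only [dt, hp, hq]
    rwa [mul_comm (A 1 0)]
  have himg := image_hull A {v | v ∈ vertices i}
  have hmem : ∀ v, toR v ∈ polygon i → toR (app p q v) ∈ polygon j := by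
    intro v hv
    rw [h, ← mulVec_toR]
    exact ⟨_, hv, rfl⟩
  have h1 := hmem (1, 0) (toR_mem_polygon.2 fun w hw => (unit_mem i w hw).1)
  have h2 := hmem (0, 1) (toR_mem_polygon.2 fun w hw => (unit_mem i w hw).2)
  have a1 : app p q (1, 0) = p := by simp [app]
  have a2 : app p q (0, 1) = q := by simp [app]
  rw [a1] at h1
  rw [a2] at h2
  have key := not_equiv i j hij
  simp only [List.all_eq_true] at key
  have := key p (mem_latticePts h1) q (mem_latticePts h2)
  rw [maps_of_subset (by rw [h]; exact himg.symm.subset), maps_of_subset] at this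
  · rcases hd with hd | hd <;> simp [hd] at this
  · refine convexHull_min ?_ (convex_convexHull ℝ _)
    rintro _ ⟨_, ⟨v, hv, rfl⟩, rfl⟩
    have hv' : toR v ∈ polygon j := toR_mem_hull hv
    rw [h] at hv'
    obtain ⟨x, hx, hxv⟩ := hv'
    have e0 := congrFun hxv 0
    have e1 := congrFun hxv 1
    simp only [Matrix.mulVec, dotProduct, Fin.sum_univ_two, Matrix.map_apply, toR,
      Matrix.cons_val_zero, Matrix.cons_val_one] at e0 e1
    have hdd : (dt p q : ℝ) * (A 0 0 * A 1 1 - A 1 0 * A 0 1) = 1 := by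
      have : dt p q * dt p q = 1 := by rcases hd with hd | hd <;> rw [hd] <;> rfl
      exact_mod_cast this
    convert hx using 1
    ext k
    fin_cases k
    · simp [toR, app, invFst, invSnd, hp, hq] at *
      rw [← e0, ← e1]
      linear_combination x 0 * hdd
    · simp [toR, app, invFst, invSnd, hp, hq] at *
      rw [← e0, ← e1]
      linear_combination x 1 * hdd

theorem exists_ip_neg_of_interior {F : Finset (ℤ × ℤ)}
    (h : (0 : Fin 2 → ℝ) ∈ interior (hull F)) {u : ℤ × ℤ} (hu : u ≠ 0) :
    ∃ f ∈ F, ip f u < 0 := by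
  by_contra! hcon
  have hcont : Filter.Tendsto (fun t : ℝ => (-t) • toR u) (nhds 0) (nhds 0) := by
    have : Continuous fun t : ℝ => (-t) • toR u := by fun_prop
    simpa using this.tendsto 0
  have hev := hcont.eventually (mem_interior_iff_mem_nhds.1 h)
  obtain ⟨t, ht, ht0⟩ := ((hev.filter_mono nhdsWithin_le_nhds).and
    (self_mem_nhdsWithin (s := Set.Ioi (0 : ℝ)))).exists
  have := le_of_mem_hull (c := 0) (y := toR u) (fun v hv => by
    have := hcon v hv
    simp only [ip] at this
    simp only [toR, Matrix.cons_val_zero, Matrix.cons_val_one]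
    have : (0 : ℝ) ≤ v.1 * u.1 + v.2 * u.2 := by exact_mod_cast this
    linarith) ht
  simp only [toR, Pi.smul_apply, smul_eq_mul, Matrix.cons_val_zero, Matrix.cons_val_one] at this
  have hpos : (0 : ℝ) < (u.1 : ℝ) * u.1 + u.2 * u.2 := by
    have : u.1 ≠ 0 ∨ u.2 ≠ 0 := by
      by_contra! h
      exact hu (Prod.ext h.1 h.2)
    rcases this with h | h
    · have : (u.1 : ℝ) ≠ 0 := by exact_mod_cast h
      nlinarith [mul_self_pos.2 this, mul_self_nonneg (u.2 : ℝ)]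
    · have : (u.2 : ℝ) ≠ 0 := by exact_mod_cast h
      nlinarith [mul_self_pos.2 this, mul_self_nonneg (u.1 : ℝ)]
  have ht0' : 0 < t := ht0
  nlinarith

theorem mem_box_of_frame {F : Finset (ℤ × ℤ)} {p q : ℤ × ℤ} (hp : InDual F p)
    (hq : InDual F q) (h : InDual F (-p - q) ∨ InDual F (-q) ∧
      (InDual F (-p) ∨ InDual F (-p + 2 * q))) :
    ∃ k, ∀ f ∈ F, (ip p f, ip q f) ≠ 0 → (ip p f, ip q f) ∈ box k := by
  rcases h with h | ⟨h, h' | h'⟩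
  · refine ⟨0, fun f hf hne => ?_⟩
    have h1 := hp f hf
    have h2 := hq f hf
    have h3 : ip p f + ip q f ≤ 1 := by
      have := h f hf
      simp only [ip, Prod.fst_sub, Prod.snd_sub, Prod.fst_neg, Prod.snd_neg] at *
      linarith
    generalize ip p f = x at *
    generalize ip q f = y at *
    have h4 : x ≤ 2 := by linarith
    interval_cases x <;> (have h5 : y ≤ 2 := by linarith) <;> interval_cases y <;>
      first | omega | exact absurd rfl hne | decide
  · refine ⟨1, fun f hf hne => ?_⟩
    have h1 := hp f hf
    have h2 := hq f hf
    have h3 : ip p f ≤ 1 := by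
      have := h' f hf
      simp only [ip, Prod.fst_neg, Prod.snd_neg] at *
      linarith
    have h4 : ip q f ≤ 1 := by
      have := h f hf
      simp only [ip, Prod.fst_neg, Prod.snd_neg] at *
      linarith
    generalize ip p f = x at *
    generalize ip q f = y at *
    interval_cases x <;> interval_cases y <;> first | exact absurd rfl hne | decide
  · refine ⟨2, fun f hf hne => ?_⟩
    have h1 := hp f hf
    have h2 := hq f hf
    have h3 : ip p f ≤ 1 + 2 * ip q f := by
      have := h' f hf
      simp only [ip, Prod.fst_add, Prod.snd_add, Prod.fst_mul, Prod.snd_mul, Prod.fst_neg,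
        Prod.snd_neg, Prod.fst_ofNat, Prod.snd_ofNat] at *
      linarith
    have h4 : ip q f ≤ 1 := by
      have := h f hf
      simp only [ip, Prod.fst_neg, Prod.snd_neg] at *
      linarith
    generalize ip p f = x at *
    generalize ip q f = y at *
    have h5 : x ≤ 3 := by linarith
    interval_cases y <;> interval_cases x <;>
      first | omega | exact absurd rfl hne | decide

theorem exists_app_subset {k : Fin 3} {F : Finset (ℤ × ℤ)}
    (hF : ∀ u : ℤ × ℤ, u ≠ 0 → ∃ f ∈ F, ip f u < 0) (hbox : ∀ f ∈ F, f ≠ 0 → f ∈ box k) :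
    ∃ (i : Fin 16) (p q : ℤ × ℤ), (dt p q = 1 ∨ dt p q = -1) ∧
      (∀ v ∈ vertices i, app p q v ∈ F) ∧
      ∀ f ∈ F, toR (app (invFst p q) (invSnd p q) f) ∈ polygon i := by
  set S := (box k).filter (· ∈ F) with hS
  have hbox0 : ∀ k : Fin 3, (0 : ℤ × ℤ) ∉ box k := by decide
  have hSF : ∀ f, f ∈ S ↔ f ∈ F ∧ f ≠ 0 := by
    intro f
    rw [hS, List.mem_filter, decide_eq_true_eq]
    exact ⟨fun h => ⟨h.2, fun h0 => hbox0 k (h0 ▸ h.1)⟩, fun h => ⟨hbox f h.1 h.2, h.1⟩⟩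
  have hneg : ∀ u : ℤ × ℤ, u ≠ 0 → ∃ s ∈ S, ip s u < 0 := by
    intro u hu
    obtain ⟨f, hf, h⟩ := hF u hu
    refine ⟨f, (hSF f).2 ⟨hf, ?_⟩, h⟩
    rintro rfl
    simp [ip] at h
  have hsur : surrounds S = true := by
    simp only [surrounds, List.all_eq_true, Bool.and_eq_true, List.any_eq_true,
      decide_eq_true_eq]
    intro t ht
    have ht0 := ((hSF t).1 ht).2
    have ht1 : ¬ (t.1 = 0 ∧ t.2 = 0) := fun h => ht0 (Prod.ext h.1 h.2)
    obtain ⟨a, ha, h1⟩ := hneg (-t.2, t.1) (by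
      rw [Ne, Prod.mk_eq_zero, neg_eq_zero]; tauto)
    obtain ⟨b, hb, h2⟩ := hneg (t.2, -t.1) (by
      rw [Ne, Prod.mk_eq_zero, neg_eq_zero]; tauto)
    simp only [ip] at h1 h2
    refine ⟨⟨a, ha, ?_⟩, b, hb, ?_⟩ <;> simp only [dt] <;> linarith
  have hne : S.isEmpty = false := by
    obtain ⟨s, hs, -⟩ := hneg (1, 0) (by simp)
    rw [List.isEmpty_eq_false_iff_exists_mem]
    exact ⟨s, hs⟩
  have key := exists_embedding k
  rw [List.all_eq_true] at key
  have key := key S (List.mem_sublists.2 List.filter_sublist)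
  rw [hne, hsur, Bool.not_true, Bool.false_or, Bool.false_or, List.any_eq_true] at key
  obtain ⟨⟨i, p, q⟩, he, h⟩ := key
  simp only [Bool.and_eq_true, List.all_eq_true, List.contains_iff_mem, maps,
    decide_eq_true_eq] at h
  refine ⟨i, p, q, unimodular_of_mem_embeddings he, fun v hv => ((hSF _).1 (h.1 v hv)).1,
    fun f hf => toR_mem_polygon.2 ?_⟩
  by_cases hf0 : f = 0
  · subst hf0
    intro w _
    simp [app, ip]
  · exact h.2 f ((hSF f).2 ⟨hf, hf0⟩)

theorem exists_glzEquiv_polygon {Δ : Set (Fin 2 → ℝ)} (h : IsReflexive Δ) :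
    ∃ i, GLZEquiv (polygon i) Δ := by
  obtain ⟨h1, h0, h2⟩ := h
  obtain ⟨F, rfl⟩ := isLatticePolytope_iff.1 h1
  obtain ⟨G, hG⟩ := isLatticePolytope_iff.1 h2
  have hFneg : ∀ u : ℤ × ℤ, u ≠ 0 → ∃ f ∈ F, ip f u < 0 := fun u =>
    exists_ip_neg_of_interior h0
  have hGneg : ∀ u : ℤ × ℤ, u ≠ 0 → ∃ g ∈ G, ip g u < 0 := fun u =>
    exists_ip_neg_of_interior (hG ▸ zero_mem_interior_dualSet F)
  obtain ⟨p, q, hpq, hp, hq, hframe⟩ := exists_frame hFneg hGneg fun g hg =>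
    toR_mem_dualSet_hull.1 (hG ▸ toR_mem_hull (S := (G : Set (ℤ × ℤ))) hg)
  obtain ⟨k, hk⟩ := mem_box_of_frame hp hq hframe
  obtain ⟨i, a, b, hab, hsub, hsup⟩ := exists_app_subset (k := k)
    (F := F.image (app (p.1, q.1) (p.2, q.2))) (by
      intro u hu
      obtain ⟨f, hf, hfu⟩ := hFneg (app p q u) (by
        intro h
        have := inv_app hpq u
        rw [h] at this
        apply hu
        rw [← this]
        simp [app])
      refine ⟨_, Finset.mem_image_of_mem _ hf, ?_⟩
      convert hfu using 1
      simp only [ip, app]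
      ring) (by
      intro f hf hf0
      obtain ⟨g, hg, rfl⟩ := Finset.mem_image.1 hf
      exact hk g hg hf0)
  refine ⟨i, ?_⟩
  have e1 := glzEquiv_hull hab {v | v ∈ vertices i}
  have e2 := glzEquiv_hull (p := (p.1, q.1)) (q := (p.2, q.2)) (by
    simp only [dt] at *
    rwa [mul_comm q.1]) (F : Set (ℤ × ℤ))
  suffices hull (app a b '' {v | v ∈ vertices i}) =
      hull (app (p.1, q.1) (p.2, q.2) '' F) from (this ▸ e1).trans e2.symm
  apply Set.Subset.antisymm
  · refine convexHull_mono (Set.image_mono ?_)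
    rintro _ ⟨v, hv, rfl⟩
    simpa using hsub v hv
  · refine convexHull_min ?_ (convex_convexHull ℝ _)
    rintro _ ⟨f, hf, rfl⟩
    have h := hsup f (by simpa using hf)
    have himg := image_hull !![a.1, b.1; a.2, b.2] {v | v ∈ vertices i}
    have hm := mulVec_toR !![a.1, b.1; a.2, b.2] (app (invFst a b) (invSnd a b) f)
    have := app_inv hab f
    refine himg.subset ⟨_, h, hm.trans (congrArg toR this)⟩

end ReflexivePolygon

/-- Up to `GL(2, ℤ)` there are exactly 16 reflexive polytopes in `ℝ²`. -/
theorem stmt_14 :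
    ∃ L : Fin 16 → Set (Fin 2 → ℝ),
      (∀ i, IsReflexive (L i)) ∧
      (∀ i j, i ≠ j → ¬ GLZEquiv (L i) (L j)) ∧
      (∀ Δ : Set (Fin 2 → ℝ), IsReflexive Δ → ∃! i : Fin 16, GLZEquiv (L i) Δ) := by
  refine ⟨ReflexivePolygon.polygon, ReflexivePolygon.isReflexive_polygon,
    fun i j => ReflexivePolygon.not_glzEquiv_polygon, fun Δ hΔ => ?_⟩
  obtain ⟨i, hi⟩ := ReflexivePolygon.exists_glzEquiv_polygon hΔ
  refine ⟨i, hi, fun j hj => ?_⟩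
  by_contra hne
  exact ReflexivePolygon.not_glzEquiv_polygon hne (hj.trans hi.symm)
end

section
/- Every reflexive polytope Δ ⊆ ℝ² is mapped by some element of GL(2, ℤ) into (i.e. onto a subset of) one of the following three reflexive polygons: T₁ = conv{(2,−1), (−1,2), (−1,−1)}, T₂ = conv{(3,−1), (−1,1), (−1,−1)}, and Q = conv{(1,1), (1,−1), (−1,1), (−1,−1)}. -/
/-- Membership in the set of lattice points of a lattice polygon whose only interior lattice point
is the origin, recorded through the three properties needed for the classification. -/
structure IsFanoLattice (L : ℤ → ℤ → Prop) : Prop where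
  conv : ∀ k a b p q r s x y : ℤ, 0 < k → 0 ≤ a → 0 ≤ b → a + b ≤ k → L p q → L r s →
    k * x = a * p + b * r → k * y = a * q + b * s → L x y
  strict : ∀ k a b p q r s x y : ℤ, 0 < k → 0 ≤ a → 0 ≤ b → a + b < k → L p q → L r s →
    k * x = a * p + b * r → k * y = a * q + b * s → x = 0 ∧ y = 0
  pos : ∀ α β : ℤ, ¬ (α = 0 ∧ β = 0) → ∃ p q, L p q ∧ α * p + β * q < 0

/-- `L` contains, up to a change of lattice basis, the vertices of the dual of one of the three
maximal reflexive polygons. -/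
def ContainsMinimal (L : ℤ → ℤ → Prop) : Prop :=
  ∃ a b c d : ℤ, IsUnit (a * d - b * c) ∧ L a b ∧ L c d ∧
    (L (-a - c) (-b - d) ∨ L (-a - 2 * c) (-b - 2 * d) ∨ (L (-a) (-b) ∧ L (-c) (-d)))

/-- Rewriting `L` in the coordinates of the basis `(a, b), (c, d)`. -/
def changeBasis (L : ℤ → ℤ → Prop) (a b c d : ℤ) (x y : ℤ) : Prop :=
  L (x * a + y * c) (x * b + y * d)

namespace IsFanoLattice

variable {L : ℤ → ℤ → Prop}

theorem changeBasis (h : IsFanoLattice L) {a b c d : ℤ} (hu : IsUnit (a * d - b * c)) :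
    IsFanoLattice (changeBasis L a b c d) := by
  have he : (a * d - b * c) * (a * d - b * c) = 1 := by
    rcases Int.isUnit_iff.1 hu with h | h <;> rw [h] <;> norm_num
  constructor
  · intro k m n p q r s x y hk hm hn hmn hp hr hx hy
    exact h.conv k m n _ _ _ _ _ _ hk hm hn hmn hp hr
      (by linear_combination a * hx + c * hy) (by linear_combination b * hx + d * hy)
  · intro k m n p q r s x y hk hm hn hmn hp hr hx hy
    obtain ⟨h1, h2⟩ := h.strict k m n _ _ _ _ (x * a + y * c) (x * b + y * d) hk hm hn hmn hp hr
      (by linear_combination a * hx + c * hy) (by linear_combination b * hx + d * hy)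
    constructor
    · linear_combination (a * d - b * c) * (d * h1 - c * h2) - x * he
    · linear_combination (a * d - b * c) * (a * h2 - b * h1) - y * he
  · intro α β hαβ
    obtain ⟨r, s, hL, hlt⟩ := h.pos ((a * d - b * c) * (α * d - β * b))
      ((a * d - b * c) * (β * a - α * c)) (by
        rintro ⟨h1, h2⟩
        apply hαβ
        constructor
        · linear_combination a * h1 + b * h2 - α * he
        · linear_combination c * h1 + d * h2 - β * he)
    refine ⟨(a * d - b * c) * (d * r - c * s), (a * d - b * c) * (a * s - b * r), ?_, ?_⟩
    · unfold _root_.changeBasis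
      convert hL using 1
      · linear_combination r * he
      · linear_combination s * he
    · linarith

end IsFanoLattice

theorem ContainsMinimal.of_changeBasis {L : ℤ → ℤ → Prop} {a b c d : ℤ}
    (hu : IsUnit (a * d - b * c)) (h : ContainsMinimal (changeBasis L a b c d)) :
    ContainsMinimal L := by
  obtain ⟨x, y, z, w, hu', h1, h2, h3⟩ := h
  unfold changeBasis at h1 h2 h3
  refine ⟨_, _, _, _, ?_, h1, h2, ?_⟩
  · convert hu'.mul hu using 1
    ring
  · rcases h3 with h3 | h3 | ⟨h3, h4⟩
    · left; convert h3 using 1 <;> ring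
    · right; left; convert h3 using 1 <;> ring
    · right; right
      constructor
      · convert h3 using 1 <;> ring
      · convert h4 using 1 <;> ring

namespace IsFanoLattice

variable {L : ℤ → ℤ → Prop}

theorem dvd_mem (h : IsFanoLattice L) {k p q : ℤ} (hk : 0 < k) (hL : L (k * p) (k * q)) :
    L p q :=
  h.conv k 1 0 _ _ _ _ p q hk (by norm_num) le_rfl (by linarith) hL hL (by ring) (by ring)

theorem exists_height_one (h : IsFanoLattice L) {p q : ℤ} (h1 : L 1 0) (hq : 0 < q)
    (hL : L p q) : ∃ x, L x 1 := by
  have hd := Int.mul_ediv_add_emod (-p) q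
  have hlt := Int.emod_lt_of_pos (-p) hq
  refine ⟨-((-p) / q), h.conv q ((-p) % q) 1 1 0 p q _ _ hq (Int.emod_nonneg _ hq.ne')
    (by norm_num) (by linarith) h1 hL ?_ (by ring)⟩
  linear_combination -hd

theorem exists_height_neg_one (h : IsFanoLattice L) {p q : ℤ} (h1 : L 1 0) (hq : q < 0)
    (hL : L p q) : ∃ x, L x (-1) := by
  have hu : IsUnit ((1 : ℤ) * (-1) - 0 * 0) := by norm_num
  obtain ⟨x, hx⟩ := (h.changeBasis hu).exists_height_one (p := p) (q := -q)
    (by simpa [_root_.changeBasis] using h1) (by linarith) (by simpa [_root_.changeBasis] using hL)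
  exact ⟨x, by simpa [_root_.changeBasis] using hx⟩

theorem containsMinimal_of_antipodal (h : IsFanoLattice L) (h1 : L 1 0) (h2 : L (-1) 0) :
    ContainsMinimal L := by
  obtain ⟨p, q, hpq, hlt⟩ := h.pos 0 (-1) (by simp)
  obtain ⟨x, hx⟩ := h.exists_height_one h1 (by linarith) hpq
  obtain ⟨r, s, hrs, hlt'⟩ := h.pos 0 1 (by simp)
  obtain ⟨y, hy⟩ := h.exists_height_neg_one h1 (by linarith) hrs
  have hle : x + y ≤ 2 := by
    by_contra! hc
    have := h.strict (x + y) 1 1 x 1 y (-1) 1 0 (by linarith) (by norm_num) (by norm_num)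
      (by linarith) hx hy (by ring) (by ring)
    simp at this
  have hge : -2 ≤ x + y := by
    by_contra! hc
    have := h.strict (-(x + y)) 1 1 x 1 y (-1) (-1) 0 (by linarith) (by norm_num) (by norm_num)
      (by linarith) hx hy (by ring) (by ring)
    simp at this
  obtain ⟨m, hm⟩ : ∃ m, m = x + y := ⟨_, rfl⟩
  obtain rfl : y = m - x := by linarith
  rw [← hm] at hle hge
  interval_cases m
  · refine ⟨x, 1, 1, 0, by norm_num, hx, h1, .inr (.inl ?_)⟩
    convert hy using 1 <;> ring
  · refine ⟨x, 1, 1, 0, by norm_num, hx, h1, .inl ?_⟩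
    convert hy using 1 <;> ring
  · refine ⟨x, 1, 1, 0, by norm_num, hx, h1, .inr (.inr ⟨?_, ?_⟩)⟩
    · convert hy using 1; ring
    · simpa using h2
  · refine ⟨x, 1, -1, 0, by norm_num, hx, h2, .inl ?_⟩
    convert hy using 1 <;> ring
  · refine ⟨x, 1, -1, 0, by norm_num, hx, h2, .inr (.inl ?_)⟩
    convert hy using 1 <;> ring

theorem containsMinimal_of_neg_of_le (h : IsFanoLattice L) (h1 : L 1 0) (h2 : L 0 1) {a b : ℤ}
    (hb : 1 ≤ b) (hab : b ≤ a) (hL : L (-a) (-b)) : ContainsMinimal L := by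
  have key (hm : L (-1) (-1)) : ContainsMinimal L :=
    ⟨1, 0, 0, 1, by norm_num, h1, h2, .inl (by simpa using hm)⟩
  rcases hab.eq_or_lt with rfl | hlt
  · exact key (h.dvd_mem (k := b) (by linarith) (by simpa using hL))
  rcases (show b + 1 ≤ a from hlt).eq_or_lt with rfl | hlt'
  · rcases hb.eq_or_lt with rfl | hb'
    · exact ⟨0, 1, 1, 0, by norm_num, h2, h1, .inr (.inl (by simpa using hL))⟩
    · exact key (h.conv b 1 1 _ _ 1 0 _ _ (by linarith) (by norm_num) (by norm_num)
        (by linarith) hL h1 (by ring) (by ring))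
  · have := h.strict a 1 b _ _ 0 1 (-1) 0 (by linarith) (by norm_num) (by linarith)
      (by linarith) hL h2 (by ring) (by ring)
    simp at this

theorem containsMinimal_of_neg (h : IsFanoLattice L) (h1 : L 1 0) (h2 : L 0 1) {p q : ℤ}
    (hp : p < 0) (hq : q < 0) (hL : L p q) : ContainsMinimal L := by
  rcases le_total p q with hpq | hpq
  · exact h.containsMinimal_of_neg_of_le h1 h2 (a := -p) (b := -q) (by linarith) (by linarith)
      (by simpa using hL)
  · have hu : IsUnit ((0 : ℤ) * 0 - 1 * 1) := by norm_num
    refine .of_changeBasis hu ((h.changeBasis hu).containsMinimal_of_neg_of_le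
      (a := -q) (b := -p) ?_ ?_ (by linarith) (by linarith) ?_) <;>
      simpa [_root_.changeBasis]

theorem containsMinimal_of_extremal (h : IsFanoLattice L) (h1 : L 1 0) (h2 : L 0 1)
    (h3 : L 2 1) (hmin : ∀ x < 0, ¬ L x 1) : ContainsMinimal L := by
  obtain ⟨p, q, hL, hlt⟩ := h.pos 1 0 (by simp)
  replace hlt : p < 0 := by linarith
  rcases lt_trichotomy q 0 with hq | rfl | hq
  · exact h.containsMinimal_of_neg h1 h2 hlt hq hL
  · exact h.containsMinimal_of_antipodal h1
      (h.dvd_mem (k := -p) (by linarith) (by simpa using hL))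
  exfalso
  rcases le_or_gt p (-q) with hpq | hpq
  · exact hmin (-1) (by norm_num) (h.conv (-p) 1 (-p - q) p q 0 1 _ _ (by linarith)
      (by norm_num) (by linarith) (by linarith) hL h2 (by ring) (by ring))
  · have := h.strict (2 * q - p) 1 (q - p) p q 2 1 1 1 (by linarith) (by norm_num)
      (by linarith) (by linarith) hL h3 (by ring) (by ring)
    simp at this

theorem exists_least_height_one (h : IsFanoLattice L) (h1 : L 1 0) {x₀ : ℤ} (hx₀ : L x₀ 1) :
    ∃ m, L m 1 ∧ ∀ x, L x 1 → m ≤ x := by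
  obtain ⟨r, s, hrs, hlt⟩ := h.pos 0 1 (by simp)
  obtain ⟨y, hy⟩ := h.exists_height_neg_one h1 (by linarith) hrs
  refine Int.exists_least_of_bdd ⟨-2 - y, fun x hx => ?_⟩ ⟨x₀, hx₀⟩
  by_contra! hc
  have := h.strict (-(x + y)) 1 1 x 1 y (-1) (-1) 0 (by linarith) (by norm_num) (by norm_num)
    (by linarith) hx hy (by ring) (by ring)
  simp at this

theorem containsMinimal_of_nonneg (h : IsFanoLattice L) (h1 : L 1 0) (h2 : L 0 1) {p q : ℤ}
    (hpq : p + q < 0) (hq : 0 ≤ q) (hL : L p q) : ContainsMinimal L := by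
  rcases hq.eq_or_lt with rfl | hq
  · exact h.containsMinimal_of_antipodal h1
      (h.dvd_mem (k := -p) (by linarith) (by simpa using hL))
  obtain rfl : q = 1 := by
    by_contra hq1
    have hq2 : 1 < q := by omega
    have := h.strict (-p) 1 (-p - q) p q 0 1 (-1) 1 (by linarith) (by norm_num)
      (by linarith) (by linarith) hL h2 (by ring) (by ring)
    simp at this
  obtain ⟨m, hm, hmin⟩ := h.exists_least_height_one h1 hL
  have hmp := hmin p hL
  have h3 : L (2 + m) 1 := h.conv (-m) (-2 - m) 2 m 1 0 1 _ _ (by linarith) (by linarith)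
    (by norm_num) (by linarith) hm h2 (by ring) (by ring)
  have hu : IsUnit ((1 : ℤ) * 1 - 0 * m) := by norm_num
  refine .of_changeBasis hu ((h.changeBasis hu).containsMinimal_of_extremal ?_ ?_ ?_ ?_)
  · simpa [_root_.changeBasis]
  · simpa [_root_.changeBasis]
  · simpa [_root_.changeBasis]
  · intro x hx hLx
    have := hmin (x + m) (by simpa [_root_.changeBasis] using hLx)
    linarith

theorem containsMinimal_of_basis (h : IsFanoLattice L) (h1 : L 1 0) (h2 : L 0 1) :
    ContainsMinimal L := by
  obtain ⟨p, q, hL, hlt⟩ := h.pos 1 1 (by simp)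
  rcases le_or_gt 0 q with hq | hq
  · exact h.containsMinimal_of_nonneg h1 h2 (by linarith) hq hL
  rcases le_or_gt 0 p with hp | hp
  · have hu : IsUnit ((0 : ℤ) * 0 - 1 * 1) := by norm_num
    refine .of_changeBasis hu ((h.changeBasis hu).containsMinimal_of_nonneg
      (p := q) (q := p) ?_ ?_ (by linarith) hp ?_) <;>
      simpa [_root_.changeBasis]
  · exact h.containsMinimal_of_neg h1 h2 hp hq hL

theorem containsMinimal (h : IsFanoLattice L) : ContainsMinimal L := by
  obtain ⟨p, q, hL, hlt⟩ := h.pos 1 0 (by simp)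
  have hp : p ≠ 0 := by rintro rfl; simp at hlt
  have hg : 0 < Int.gcd p q := Int.gcd_pos_of_ne_zero_left _ hp
  obtain ⟨p', q', hc, hp', hq'⟩ := Int.exists_gcd_one hg
  have hL' : L p' q' := h.dvd_mem (k := Int.gcd p q) (by exact_mod_cast hg) (by
    rw [mul_comm, ← hp', mul_comm, ← hq']; exact hL)
  have hb := Int.gcd_eq_gcd_ab p' q'
  rw [hc] at hb
  have hu : IsUnit (p' * Int.gcdA p' q' - q' * (-Int.gcdB p' q')) := by
    rw [show p' * Int.gcdA p' q' - q' * (-Int.gcdB p' q') = 1 by push_cast at hb; linarith]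
    exact isUnit_one
  refine .of_changeBasis hu ?_
  have h' := h.changeBasis hu
  have h1 : _root_.changeBasis L p' q' (-Int.gcdB p' q') (Int.gcdA p' q') 1 0 := by
    simpa [_root_.changeBasis] using hL'
  obtain ⟨r, s, hrs, hlt'⟩ := h'.pos 0 (-1) (by simp)
  obtain ⟨x, hx⟩ := h'.exists_height_one h1 (by linarith) hrs
  have hv : IsUnit ((1 : ℤ) * 1 - 0 * x) := by norm_num
  refine .of_changeBasis hv ((h'.changeBasis hv).containsMinimal_of_basis ?_ ?_)
  · unfold _root_.changeBasis at h1 ⊢; simpa using h1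
  · unfold _root_.changeBasis at hx ⊢; simpa using hx

end IsFanoLattice

theorem le_of_mem_convexHull {F : Set (Fin 2 → ℝ)} {a b c : ℝ}
    (hF : ∀ x ∈ F, c ≤ a * x 0 + b * x 1) : ∀ x ∈ convexHull ℝ F, c ≤ a * x 0 + b * x 1 := by
  refine fun x hx => convexHull_min (t := {x : Fin 2 → ℝ | c ≤ a * x 0 + b * x 1}) hF ?_ hx
  intro x hx y hy s t hs ht hst
  simp only [Set.mem_ofPred_eq, Pi.add_apply, Pi.smul_apply, smul_eq_mul] at *
  obtain rfl : t = 1 - s := by linarith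
  nlinarith

theorem exists_pos_smul_mem_of_mem_interior {s : Set (Fin 2 → ℝ)} (hs : 0 ∈ interior s)
    (v : Fin 2 → ℝ) : ∃ ε : ℝ, 0 < ε ∧ ε • v ∈ s := by
  have hc : Filter.Tendsto (fun ε : ℝ => ε • v) (nhdsWithin 0 (Set.Ioi 0)) (nhds 0) := by
    have : Continuous fun ε : ℝ => ε • v := by fun_prop
    simpa using (this.tendsto 0).mono_left nhdsWithin_le_nhds
  have hev := hc.eventually (mem_interior_iff_mem_nhds.1 hs)
  obtain ⟨ε, h1, h2⟩ := (hev.and self_mem_nhdsWithin).exists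
  exact ⟨ε, h2, h1⟩

theorem exists_pos_smul_mem_dualSet {s : Set (Fin 2 → ℝ)} (hs : Bornology.IsBounded s)
    (v : Fin 2 → ℝ) : ∃ ε : ℝ, 0 < ε ∧ ε • v ∈ dualSet s := by
  obtain ⟨C, hC0, hC⟩ := hs.exists_pos_norm_le
  have hM : 0 < C * (|v 0| + |v 1| + 1) := by positivity
  refine ⟨(C * (|v 0| + |v 1| + 1))⁻¹, inv_pos.2 hM, fun x hx => ?_⟩
  have hx0 := (norm_le_pi_norm x 0).trans (hC x hx)
  have hx1 := (norm_le_pi_norm x 1).trans (hC x hx)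
  rw [Real.norm_eq_abs] at hx0 hx1
  have e0 : |v 0 * x 0| ≤ |v 0| * C := by rw [abs_mul]; gcongr
  have e1 : |v 1 * x 1| ≤ |v 1| * C := by rw [abs_mul]; gcongr
  have key : -(C * (|v 0| + |v 1| + 1)) ≤ v 0 * x 0 + v 1 * x 1 := by
    linarith [neg_abs_le (v 0 * x 0), neg_abs_le (v 1 * x 1)]
  have := mul_le_mul_of_nonneg_left key (inv_pos.2 hM).le
  rw [mul_neg, inv_mul_cancel₀ hM.ne'] at this
  simp only [Fin.sum_univ_two, Pi.smul_apply, smul_eq_mul]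
  linarith

theorem IsReflexive.isFanoLattice {Δ : Set (Fin 2 → ℝ)} (h : IsReflexive Δ) :
    IsFanoLattice fun p q => ∀ x ∈ Δ, (-1 : ℝ) ≤ p * x 0 + q * x 1 := by
  obtain ⟨⟨F, hFfin, hF, rfl⟩, h0, G, -, hG, hdual⟩ := h
  constructor
  · intro k a b p q r s x y hk ha hb hab hp hr hx hy z hz
    have hk' : (0 : ℝ) < k := by exact_mod_cast hk
    have ha' : (0 : ℝ) ≤ a := by exact_mod_cast ha
    have hb' : (0 : ℝ) ≤ b := by exact_mod_cast hb
    have hab' : (a : ℝ) + b ≤ k := by exact_mod_cast hab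
    have hx' : (k : ℝ) * x = a * p + b * r := by exact_mod_cast hx
    have hy' : (k : ℝ) * y = a * q + b * s := by exact_mod_cast hy
    have h1 := mul_le_mul_of_nonneg_left (hp z hz) ha'
    have h2 := mul_le_mul_of_nonneg_left (hr z hz) hb'
    refine le_of_mul_le_mul_left ?_ hk'
    have : (k : ℝ) * (x * z 0 + y * z 1)
        = a * (p * z 0 + q * z 1) + b * (r * z 0 + s * z 1) := by
      linear_combination z 0 * hx' + z 1 * hy'
    linarith
  · intro k a b p q r s x y hk ha hb hab hp hr hx hy
    have hnonneg : ∀ z ∈ F, (0 : ℝ) ≤ x * z 0 + y * z 1 := by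
      intro z hz
      obtain ⟨m, hm⟩ := hF z hz 0
      obtain ⟨n, hn⟩ := hF z hz 1
      have hp' := hp z (subset_convexHull ℝ F hz)
      have hr' := hr z (subset_convexHull ℝ F hz)
      rw [hm, hn] at hp' hr' ⊢
      norm_cast at hp' hr' ⊢
      change -1 ≤ _ at hp'
      change -1 ≤ _ at hr'
      have h1 := mul_le_mul_of_nonneg_left hp' ha
      have h2 := mul_le_mul_of_nonneg_left hr' hb
      have : k * (x * m + y * n) = a * (p * m + q * n) + b * (r * m + s * n) := by
        linear_combination m * hx + n * hy
      by_contra! hc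
      have := mul_le_mul_of_nonneg_left (Int.le_sub_one_of_lt hc) hk.le
      linarith
    obtain ⟨ε, hε, hmem⟩ := exists_pos_smul_mem_of_mem_interior h0 ![-(x : ℝ), -(y : ℝ)]
    have := le_of_mem_convexHull hnonneg _ hmem
    simp only [Pi.smul_apply, Matrix.cons_val_zero, Matrix.cons_val_one, smul_eq_mul] at this
    have hsq : (x : ℝ) ^ 2 + (y : ℝ) ^ 2 ≤ 0 := by
      by_contra! hc
      nlinarith
    norm_cast at hsq
    constructor <;> nlinarith
  · intro α β hαβ
    obtain ⟨ε, hε, hmem⟩ := exists_pos_smul_mem_dualSet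
      (isBounded_convexHull.2 hFfin.isBounded) ![-(α : ℝ), -(β : ℝ)]
    by_contra! hc
    have hGn : ∀ y ∈ G, (0 : ℝ) ≤ α * y 0 + β * y 1 := by
      intro y hy
      obtain ⟨m, hm⟩ := hG y hy 0
      obtain ⟨n, hn⟩ := hG y hy 1
      have hyd : y ∈ dualSet (convexHull ℝ F) := hdual ▸ subset_convexHull ℝ G hy
      have := hc m n fun x hx => by
        have := hyd x hx
        rwa [Fin.sum_univ_two, hm, hn] at this
      rw [hm, hn]
      exact_mod_cast this
    rw [hdual] at hmem
    have := le_of_mem_convexHull hGn _ hmem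
    simp only [Pi.smul_apply, Matrix.cons_val_zero, Matrix.cons_val_one, smul_eq_mul] at this
    have hsq : (α : ℝ) ^ 2 + (β : ℝ) ^ 2 ≤ 0 := by
      by_contra! hc
      nlinarith
    norm_cast at hsq
    exact hαβ ⟨by nlinarith, by nlinarith⟩

theorem mem_convexHull_of_sum_smul {ι : Type*} [Fintype ι] {s : Set (Fin 2 → ℝ)} (w : ι → ℝ)
    (z : ι → Fin 2 → ℝ) (hw : ∀ i, 0 ≤ w i) (hsum : ∑ i, w i = 1) (hz : ∀ i, z i ∈ s)
    {x : Fin 2 → ℝ} (hx : ∑ i, w i • z i = x) : x ∈ convexHull ℝ s :=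
  hx ▸ (convex_convexHull ℝ s).sum_mem (fun i _ => hw i) hsum
    fun i _ => subset_convexHull ℝ s (hz i)

theorem mem_triangle_of_add_le {x : Fin 2 → ℝ} (h0 : -1 ≤ x 0) (h1 : -1 ≤ x 1)
    (h2 : x 0 + x 1 ≤ 1) :
    x ∈ convexHull ℝ ({![2, -1], ![-1, 2], ![-1, -1]} : Set (Fin 2 → ℝ)) := by
  refine mem_convexHull_of_sum_smul ![(x 0 + 1) / 3, (x 1 + 1) / 3, (1 - x 0 - x 1) / 3]
    ![![2, -1], ![-1, 2], ![-1, -1]] ?_ ?_ ?_ ?_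
  · simp only [Fin.forall_fin_succ]
    simp
    refine ⟨?_, ?_, ?_⟩ <;> linarith
  · simp [Fin.sum_univ_succ]; ring
  · simp [Fin.forall_fin_succ]
  · ext i; fin_cases i <;> simp [Fin.sum_univ_succ] <;> ring

theorem mem_triangle_of_add_two_mul_le {x : Fin 2 → ℝ} (h0 : -1 ≤ x 0) (h1 : -1 ≤ x 1)
    (h2 : x 0 + 2 * x 1 ≤ 1) :
    x ∈ convexHull ℝ ({![3, -1], ![-1, 1], ![-1, -1]} : Set (Fin 2 → ℝ)) := by
  refine mem_convexHull_of_sum_smul ![(x 0 + 1) / 4, (x 1 + 1) / 2, (1 - x 0 - 2 * x 1) / 4]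
    ![![3, -1], ![-1, 1], ![-1, -1]] ?_ ?_ ?_ ?_
  · simp only [Fin.forall_fin_succ]
    simp
    refine ⟨?_, ?_, ?_⟩ <;> linarith
  · simp [Fin.sum_univ_succ]; ring
  · simp [Fin.forall_fin_succ]
  · ext i; fin_cases i <;> simp [Fin.sum_univ_succ] <;> ring

theorem mem_square_of_le {x : Fin 2 → ℝ} (h0 : -1 ≤ x 0) (h1 : -1 ≤ x 1)
    (h2 : x 0 ≤ 1) (h3 : x 1 ≤ 1) :
    x ∈ convexHull ℝ ({![1, 1], ![1, -1], ![-1, 1], ![-1, -1]} : Set (Fin 2 → ℝ)) := by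
  refine mem_convexHull_of_sum_smul
    ![(1 + x 0) * (1 + x 1) / 4, (1 + x 0) * (1 - x 1) / 4,
      (1 - x 0) * (1 + x 1) / 4, (1 - x 0) * (1 - x 1) / 4]
    ![![1, 1], ![1, -1], ![-1, 1], ![-1, -1]] ?_ ?_ ?_ ?_
  · simp only [Fin.forall_fin_succ]
    simp
    refine ⟨?_, ?_, ?_, ?_⟩ <;> nlinarith
  · simp [Fin.sum_univ_succ]; ring
  · simp [Fin.forall_fin_succ]
  · ext i; fin_cases i <;> simp [Fin.sum_univ_succ] <;> ring

/-- Every reflexive polytope in `ℝ²` is mapped by some element of `GL(2, ℤ)` into one of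
the three maximal reflexive polygons `T₁`, `T₂`, `Q`. -/
theorem stmt_15 (Δ : Set (Fin 2 → ℝ)) (h : IsReflexive Δ) :
    ∃ A : Matrix (Fin 2) (Fin 2) ℤ, IsUnit A.det ∧
      ((fun x => (A.map ((↑) : ℤ → ℝ)).mulVec x) '' Δ ⊆
          convexHull ℝ ({![2, -1], ![-1, 2], ![-1, -1]} : Set (Fin 2 → ℝ)) ∨
       (fun x => (A.map ((↑) : ℤ → ℝ)).mulVec x) '' Δ ⊆
          convexHull ℝ ({![3, -1], ![-1, 1], ![-1, -1]} : Set (Fin 2 → ℝ)) ∨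
       (fun x => (A.map ((↑) : ℤ → ℝ)).mulVec x) '' Δ ⊆
          convexHull ℝ ({![1, 1], ![1, -1], ![-1, 1], ![-1, -1]} : Set (Fin 2 → ℝ))) := by
  obtain ⟨a, b, c, d, hu, h1, h2, h3⟩ := h.isFanoLattice.containsMinimal
  refine ⟨!![a, b; c, d], by rwa [Matrix.det_fin_two_of], ?_⟩
  rcases h3 with h3 | h3 | ⟨h3, h4⟩
  · left
    rintro _ ⟨x, hx, rfl⟩
    have e1 := h1 x hx
    have e2 := h2 x hx
    have e3 := h3 x hx
    push_cast at e3
    apply mem_triangle_of_add_le <;> simp [Matrix.mulVec, dotProduct] <;> linarith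
  · right; left
    rintro _ ⟨x, hx, rfl⟩
    have e1 := h1 x hx
    have e2 := h2 x hx
    have e3 := h3 x hx
    push_cast at e3
    apply mem_triangle_of_add_two_mul_le <;> simp [Matrix.mulVec, dotProduct] <;> linarith
  · right; right
    rintro _ ⟨x, hx, rfl⟩
    have e1 := h1 x hx
    have e2 := h2 x hx
    have e3 := h3 x hx
    have e4 := h4 x hx
    push_cast at e3 e4
    apply mem_square_of_le <;> simp [Matrix.mulVec, dotProduct] <;> linarith
end
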